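/- Let Z be a PMM satisfying assumptions A1 and A2, and suppose Z is Harris recurrent. Then for all fixed l, s ≥ 1, almost surely sup_{n ≥ t} sup_{m ≥ 1} ‖ν^t_{l:n;m} − ν^t_{s:n;m}‖_TV → 0 as t → ∞. -/

import Mathlib

open MeasureTheory ProbabilityTheory ENNReal

namespace PMMPaper

/-! ### General Markov chain notions (general state space) -/

section Kernels

variable {S : Type*} [MeasurableSpace S]

open Classical in
/-- `kpow κ k` is the `k`-step transition kernel of a Markov chain with one-step kernel `κ`. -/
noncomputable def kpow (κ : Kernel S S) : ℕ → Kernel S S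
  | 0 => Kernel.id
  | n + 1 => kpow κ n ∘ₖ κ

/-- `φ` is an irreducibility measure for the chain with kernel `κ`:
`φ(A) > 0` implies that from every point `z` some `k`-step transition reaches `A`
with positive probability. -/
def IsIrreducibilityMeasure (κ : Kernel S S) (φ : Measure S) : Prop :=
  ∀ A : Set S, MeasurableSet A → 0 < φ A → ∀ z : S, ∃ k : ℕ, 1 ≤ k ∧ 0 < kpow κ k z A

/-- `ψ` is a maximal irreducibility measure: a σ-finite irreducibility measure dominating
every other σ-finite irreducibility measure. -/
def IsMaxIrreducibilityMeasure (κ : Kernel S S) (ψ : Measure S) : Prop :=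
  SigmaFinite ψ ∧ IsIrreducibilityMeasure κ ψ ∧
    ∀ φ : Measure S, SigmaFinite φ → IsIrreducibilityMeasure κ φ → φ ≪ ψ

/-- `Pz` is the family of laws (on the path space `ℕ → S`) of the Markov chain with
transition kernel `κ` started at the point `z`:  `Pz z` is a probability measure under which
the coordinate process starts at `z` and is Markov with kernel `κ`. -/
def IsMarkovFamily (κ : Kernel S S) (Pz : S → Measure (ℕ → S)) : Prop :=
  (∀ z : S, IsProbabilityMeasure (Pz z)) ∧
  (∀ z : S, Pz z {ω | ω 0 = z} = 1) ∧
  ∀ (z : S) (n : ℕ) (g : S → ℝ≥0∞), Measurable g → ∀ C : Set (ℕ → S),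
    MeasurableSet[⨆ i ∈ Set.Iic n, MeasurableSpace.comap (fun ω : ℕ → S => ω i) inferInstance] C →
    ∫⁻ ω in C, g (ω (n + 1)) ∂(Pz z) = ∫⁻ ω in C, ∫⁻ z', g z' ∂(κ (ω n)) ∂(Pz z)

/-- Harris recurrence property (relative to the measure `ψ`): every set charged by `ψ` is
visited infinitely often, almost surely, from every starting point. -/
def HarrisProp (κ : Kernel S S) (Pz : S → Measure (ℕ → S)) (ψ : Measure S) : Prop :=
  ∀ A : Set S, MeasurableSet A → 0 < ψ A → ∀ z : S,
    Pz z {ω | ∀ N : ℕ, ∃ k : ℕ, N ≤ k ∧ ω k ∈ A} = 1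

/-- `π` is an invariant measure for the kernel `κ`. -/
def IsInvariantMeasure (κ : Kernel S S) (π : Measure S) : Prop :=
  π.bind (fun z => κ z) = π

/-- The chain is positive: its transition kernel admits an invariant probability measure. -/
def IsPositive (κ : Kernel S S) : Prop :=
  ∃ π : Measure S, IsProbabilityMeasure π ∧ IsInvariantMeasure κ π

/-- The process `Z` on `(Ω, P)` is a homogeneous Markov chain with transition kernel `κ`. -/
def IsMarkovChain {Ω : Type*} [MeasurableSpace Ω] (P : Measure Ω) (Z : ℕ → Ω → S)
    (κ : Kernel S S) : Prop :=
  (∀ k : ℕ, Measurable (Z k)) ∧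
  ∀ (n : ℕ) (g : S → ℝ≥0∞), Measurable g → ∀ C : Set Ω,
    MeasurableSet[⨆ i ∈ Set.Iic n, MeasurableSpace.comap (Z i) inferInstance] C →
    ∫⁻ ω in C, g (Z (n + 1) ω) ∂P = ∫⁻ ω in C, ∫⁻ z', g z' ∂(κ (Z n ω)) ∂P

/-- The process `Z : ℤ → Ω → S` on `(Ω, P)` is a (two-sided) homogeneous Markov chain
with transition kernel `κ`. -/
def IsMarkovChainZ {Ω : Type*} [MeasurableSpace Ω] (P : Measure Ω) (Z : ℤ → Ω → S)
    (κ : Kernel S S) : Prop :=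
  (∀ k : ℤ, Measurable (Z k)) ∧
  ∀ (n : ℤ) (g : S → ℝ≥0∞), Measurable g → ∀ C : Set Ω,
    MeasurableSet[⨆ i ∈ Set.Iic n, MeasurableSpace.comap (Z i) inferInstance] C →
    ∫⁻ ω in C, g (Z (n + 1) ω) ∂P = ∫⁻ ω in C, ∫⁻ z', g z' ∂(κ (Z n ω)) ∂P

/-- The reversed-time process of the two-sided chain `Z` is a Markov chain with kernel `κ'`. -/
def IsRevMarkovChainZ {Ω : Type*} [MeasurableSpace Ω] (P : Measure Ω) (Z : ℤ → Ω → S)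
    (κ' : Kernel S S) : Prop :=
  ∀ (n : ℤ) (g : S → ℝ≥0∞), Measurable g → ∀ C : Set Ω,
    MeasurableSet[⨆ i ∈ Set.Ici n, MeasurableSpace.comap (Z i) inferInstance] C →
    ∫⁻ ω in C, g (Z (n - 1) ω) ∂P = ∫⁻ ω in C, ∫⁻ z', g z' ∂(κ' (Z n ω)) ∂P

/-- The two-sided process `Z` is stationary: all finite-dimensional distributions are
invariant under time shifts. -/
def IsStationaryZ {Ω : Type*} [MeasurableSpace Ω] (P : Measure Ω) (Z : ℤ → Ω → S) : Prop :=
  ∀ (k : ℤ) (n : ℕ),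
    P.map (fun ω => fun i : Fin n => Z (k + (i : ℕ)) ω) =
      P.map (fun ω => fun i : Fin n => Z ((i : ℕ) : ℤ) ω)

/-- First-coordinate projection `A_(1)` of a set of finite strings. -/
def proj1 {α : Type*} {R : ℕ} (A : Set (Fin (R + 1) → α)) : Set α :=
  (fun x => x 0) '' A

/-- The section `A(a) = {x_{2:r} : (a, x_{2:r}) ∈ A}`. -/
def secSet {α : Type*} {R : ℕ} (A : Set (Fin (R + 1) → α)) (a : α) : Set (Fin R → α) :=
  {xr | Fin.cons a xr ∈ A}

end Kernels

/-! ### Pairwise Markov models -/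

variable {𝓧 : Type*} [MeasurableSpace 𝓧] {𝓨 : Type*} [Fintype 𝓨] [DecidableEq 𝓨]
  [MeasurableSpace 𝓨] [MeasurableSingletonClass 𝓨] [Nonempty 𝓨]
  {Ω : Type*} [MeasurableSpace Ω]

/-- `Z` is a pairwise Markov model on `(Ω, P)`: a homogeneous Markov chain on `𝓧 × 𝓨`
whose transition kernel `κ` has density `q(z'|z)` with respect to `μ × count`, and whose
initial distribution has density `p0` with respect to `μ × count`. -/
def IsPMM (P : Measure Ω) (Z : ℕ → Ω → 𝓧 × 𝓨) (κ : Kernel (𝓧 × 𝓨) (𝓧 × 𝓨))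
    (μ : Measure 𝓧) (q : 𝓧 × 𝓨 → 𝓧 × 𝓨 → ℝ≥0∞) (p0 : 𝓧 × 𝓨 → ℝ≥0∞) : Prop :=
  IsProbabilityMeasure P ∧ IsMarkovChain P Z κ ∧ SigmaFinite μ ∧
  Measurable (Function.uncurry q) ∧ Measurable p0 ∧
  (∀ z : 𝓧 × 𝓨, (κ z : Measure (𝓧 × 𝓨)) =
      (μ.prod Measure.count).withDensity (fun z' => q z' z)) ∧
  P.map (Z 0) = (μ.prod Measure.count).withDensity p0

/-- Two-sided version of `IsPMM`. -/
def IsPMMZ (P : Measure Ω) (Z : ℤ → Ω → 𝓧 × 𝓨) (κ : Kernel (𝓧 × 𝓨) (𝓧 × 𝓨))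
    (μ : Measure 𝓧) (q : 𝓧 × 𝓨 → 𝓧 × 𝓨 → ℝ≥0∞) (p0 : 𝓧 × 𝓨 → ℝ≥0∞) : Prop :=
  IsProbabilityMeasure P ∧ IsMarkovChainZ P Z κ ∧ SigmaFinite μ ∧
  Measurable (Function.uncurry q) ∧ Measurable p0 ∧
  (∀ z : 𝓧 × 𝓨, (κ z : Measure (𝓧 × 𝓨)) =
      (μ.prod Measure.count).withDensity (fun z' => q z' z)) ∧
  P.map (Z 0) = (μ.prod Measure.count).withDensity p0

/-- `pijD q x i j` is the conditional density
`p_{ij}(x_{1:r}) = p(x_{2:r}, y_r = j | x_1, y_1 = i)` (a string `x` of length `R+1`). -/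
noncomputable def pijD (q : 𝓧 × 𝓨 → 𝓧 × 𝓨 → ℝ≥0∞) {R : ℕ} (x : Fin (R + 1) → 𝓧)
    (i j : 𝓨) : ℝ≥0∞ :=
  ∑ y : Fin (R + 1) → 𝓨,
    (if y 0 = i ∧ y (Fin.last R) = j then
      ∏ k : Fin R, q (x k.succ, y k.succ) (x k.castSucc, y k.castSucc) else 0)

/-- `pmidD q x i t j` is the density `p(y_{t+1} = j, x_{2:r} | x_1, y_1 = i)`. -/
noncomputable def pmidD (q : 𝓧 × 𝓨 → 𝓧 × 𝓨 → ℝ≥0∞) {R : ℕ} (x : Fin (R + 1) → 𝓧)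
    (i : 𝓨) (t : Fin (R + 1)) (j : 𝓨) : ℝ≥0∞ :=
  ∑ y : Fin (R + 1) → 𝓨,
    (if y 0 = i ∧ y t = j then
      ∏ k : Fin R, q (x k.succ, y k.succ) (x k.castSucc, y k.castSucc) else 0)

/-- `pxD q x i = p(x_{2:r} | x_1, y_1 = i)`. -/
noncomputable def pxD (q : 𝓧 × 𝓨 → 𝓧 × 𝓨 → ℝ≥0∞) {R : ℕ} (x : Fin (R + 1) → 𝓧)
    (i : 𝓨) : ℝ≥0∞ :=
  ∑ j : 𝓨, pijD q x i j

/-- The set `Y⁺(x_{1:r}) = {(i,j) : p_{ij}(x_{1:r}) > 0}`. -/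
def Yplus (q : 𝓧 × 𝓨 → 𝓧 × 𝓨 → ℝ≥0∞) {R : ℕ} (x : Fin (R + 1) → 𝓧) : Set (𝓨 × 𝓨) :=
  {p : 𝓨 × 𝓨 | 0 < pijD q x p.1 p.2}

/-- Joint density `p(x_{1:r}, y_{1:r})` of `Z_{1:r}`, built from the initial density `p0`
and the transition density `q`. -/
noncomputable def jointD (p0 : 𝓧 × 𝓨 → ℝ≥0∞) (q : 𝓧 × 𝓨 → 𝓧 × 𝓨 → ℝ≥0∞) {R : ℕ}
    (x : Fin (R + 1) → 𝓧) (y : Fin (R + 1) → 𝓨) : ℝ≥0∞ :=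
  p0 (x 0, y 0) * ∏ k : Fin R, q (x k.succ, y k.succ) (x k.castSucc, y k.castSucc)

/-- Density `p(x_{1:r})` of the observations `X_{1:r}`. -/
noncomputable def pXD (p0 : 𝓧 × 𝓨 → ℝ≥0∞) (q : 𝓧 × 𝓨 → 𝓧 × 𝓨 → ℝ≥0∞) {R : ℕ}
    (x : Fin (R + 1) → 𝓧) : ℝ≥0∞ :=
  ∑ y : Fin (R + 1) → 𝓨, jointD p0 q x y

/-- The set `Y*(x_{1:r}) = {(y_1, y_r) : ∃ y_{2:r-1}, p(x_{1:r}, y_{1:r}) > 0}`. -/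
def Ystar (p0 : 𝓧 × 𝓨 → ℝ≥0∞) (q : 𝓧 × 𝓨 → 𝓧 × 𝓨 → ℝ≥0∞) {R : ℕ}
    (x : Fin (R + 1) → 𝓧) : Set (𝓨 × 𝓨) :=
  {p : 𝓨 × 𝓨 | ∃ y : Fin (R + 1) → 𝓨,
    y 0 = p.1 ∧ y (Fin.last R) = p.2 ∧ 0 < jointD p0 q x y}

/-- Assumption **A1**: there is `r = R + 1 > 1` and a set `E ⊆ 𝓧^r` on which
`Y⁺(x_{1:r}) = Y⁺` is constant, nonempty, and a product set. -/
def Assumption1 (q : 𝓧 × 𝓨 → 𝓧 × 𝓨 → ℝ≥0∞) {R : ℕ} (E : Set (Fin (R + 1) → 𝓧))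
    (Yp : Set (𝓨 × 𝓨)) : Prop :=
  1 ≤ R ∧ Yp.Nonempty ∧ (∀ x ∈ E, Yplus q x = Yp) ∧
    Yp = (Prod.fst '' Yp) ×ˢ (Prod.snd '' Yp)

/-- Assumption **A2**: `ψ` is a maximal irreducibility measure for the chain,
`ψ(E_(1) × Y⁺_(1)) > 0` and `μ^{r-1}(E(x₁)) > 0` for all `x₁ ∈ E_(1)`. -/
def Assumption2 (κ : Kernel (𝓧 × 𝓨) (𝓧 × 𝓨)) (ψ : Measure (𝓧 × 𝓨)) (μ : Measure 𝓧)
    {R : ℕ} (E : Set (Fin (R + 1) → 𝓧)) (Yp : Set (𝓨 × 𝓨)) : Prop :=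
  IsMaxIrreducibilityMeasure κ ψ ∧
  0 < ψ (proj1 E ×ˢ (Prod.fst '' Yp)) ∧
  ∀ x₁ ∈ proj1 E, 0 < (Measure.pi fun _ : Fin R => μ) (secSet E x₁)

/-- Assumption **A1'** (stationary case): `Y*(x_{1:r}) = Y*` is constant on `E`,
nonempty and a product set. -/
def Assumption1' (p0 : 𝓧 × 𝓨 → ℝ≥0∞) (q : 𝓧 × 𝓨 → 𝓧 × 𝓨 → ℝ≥0∞) {R : ℕ}
    (E : Set (Fin (R + 1) → 𝓧)) (Ys : Set (𝓨 × 𝓨)) : Prop :=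
  1 ≤ R ∧ Ys.Nonempty ∧ (∀ x ∈ E, Ystar p0 q x = Ys) ∧
    Ys = (Prod.fst '' Ys) ×ˢ (Prod.snd '' Ys)

/-- Assumption **A2'**: `μ^r(E) > 0`. -/
def Assumption2' (μ : Measure 𝓧) {R : ℕ} (E : Set (Fin (R + 1) → 𝓧)) : Prop :=
  0 < (Measure.pi fun _ : Fin (R + 1) => μ) E

/-! ### Smoothing distributions -/

/-- The σ-algebra `σ(X_{l:n})` generated by the observations with indices in `[l, n]`. -/
noncomputable def obsSigma (Z : ℕ → Ω → 𝓧 × 𝓨) (l n : ℕ) : MeasurableSpace Ω :=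
  ⨆ i ∈ Set.Icc l n, MeasurableSpace.comap (fun ω => (Z i ω).1) inferInstance

/-- The σ-algebra `σ(X_{s:∞})` generated by the observations with indices `≥ s`. -/
noncomputable def obsSigmaFrom (Z : ℕ → Ω → 𝓧 × 𝓨) (s : ℕ) : MeasurableSpace Ω :=
  ⨆ i ∈ Set.Ici s, MeasurableSpace.comap (fun ω => (Z i ω).1) inferInstance

/-- The smoothing probability `ν^t_{l:n;m}(v) = P(Y_{t:t+m-1} = v | X_{l:n})`,
realized as a conditional expectation of an indicator. -/
noncomputable def smooth (P : Measure Ω) (Z : ℕ → Ω → 𝓧 × 𝓨) (t l n : ℕ) {m : ℕ}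
    (v : Fin m → 𝓨) : Ω → ℝ :=
  P[Set.indicator {ω | ∀ i : Fin m, (Z (t + (i : ℕ)) ω).2 = v i} (fun _ => (1 : ℝ)) |
    obsSigma Z l n]

/-- Total variation distance `‖ν^t_{l:n;m} − ν^t_{s:n;m}‖_TV`. -/
noncomputable def tvBlock (P : Measure Ω) (Z : ℕ → Ω → 𝓧 × 𝓨) (t l s n m : ℕ) (ω : Ω) : ℝ :=
  ∑ v : Fin m → 𝓨, |smooth P Z t l n v ω - smooth P Z t s n v ω|

/-- Two-sided version: the σ-algebra `σ(X_i ; i ∈ I)` for `I ⊆ ℤ`. -/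
noncomputable def obsSigmaZ (Z : ℤ → Ω → 𝓧 × 𝓨) (I : Set ℤ) : MeasurableSpace Ω :=
  ⨆ i ∈ I, MeasurableSpace.comap (fun ω => (Z i ω).1) inferInstance

/-- Two-sided smoothing probability `P(Y_{t:t+m-1} = v | X_i ; i ∈ I)`. -/
noncomputable def smoothZ (P : Measure Ω) (Z : ℤ → Ω → 𝓧 × 𝓨) (t : ℤ) (I : Set ℤ) {m : ℕ}
    (v : Fin m → 𝓨) : Ω → ℝ :=
  P[Set.indicator {ω | ∀ i : Fin m, (Z (t + (i : ℕ)) ω).2 = v i} (fun _ => (1 : ℝ)) |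
    obsSigmaZ Z I]

/-- Two-sided total variation distance between smoothing distributions with observation
index sets `I` and `J`. -/
noncomputable def tvBlockZ (P : Measure Ω) (Z : ℤ → Ω → 𝓧 × 𝓨) (t : ℤ) (I J : Set ℤ)
    (m : ℕ) (ω : Ω) : ℝ :=
  ∑ v : Fin m → 𝓨, |smoothZ P Z t I v ω - smoothZ P Z t J v ω|

/-! ### Counters, Doeblin matrices -/

/-- `κ_k(X_{s:t})`: the number of (almost non-overlapping) `E`-blocks of length `R+1`
in the observed string, counting from position `s + k` (paper's `κ_k`, `r' = R`). -/
noncomputable def kapCount (Z : ℕ → Ω → 𝓧 × 𝓨) {R : ℕ} (E : Set (Fin (R + 1) → 𝓧))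
    (s t kk : ℕ) (ω : Ω) : ℕ :=
  ∑ u ∈ Finset.range ((t - kk - s) / R),
    Set.indicator E (fun _ => 1) (fun i : Fin (R + 1) => (Z (u * R + s + kk + (i : ℕ)) ω).1)

/-- `κ̄(X_{s:t})`: the backward counter, counting `E`-blocks from position `t` backwards. -/
noncomputable def kapBar (Z : ℕ → Ω → 𝓧 × 𝓨) {R : ℕ} (E : Set (Fin (R + 1) → 𝓧))
    (s t : ℕ) (ω : Ω) : ℕ :=
  ∑ u ∈ Finset.range ((t - s) / R),
    Set.indicator E (fun _ => 1) (fun i : Fin (R + 1) => (Z (t - (u + 1) * R + (i : ℕ)) ω).1)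

open Classical in
/-- The segment `x_{a+1:b+1}` (0-based indices `a..b`) of a string of length `L+1`. -/
def segv {L : ℕ} (x : Fin (L + 1) → 𝓧) (a b : ℕ) (hab : a ≤ b) (hb : b ≤ L) :
    Fin (b - a + 1) → 𝓧 :=
  fun i => x ⟨a + (i : ℕ), by omega⟩

/-- Normalizing constant `c(x_{r:n}) = ∑_{j ∈ Y₂} p(x_{r+1:n} | x_r, y_r = j)`. -/
noncomputable def normC (q : 𝓧 × 𝓨 → 𝓧 × 𝓨 → ℝ≥0∞) (Y2 : Set 𝓨) {M : ℕ}
    (w : Fin (M + 1) → 𝓧) : ℝ≥0∞ :=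
  ∑ j : 𝓨, Set.indicator Y2 (fun j' => pxD q w j') j

/-- The probability vector `λ[x_{r:n}](j)`. -/
noncomputable def lamD (q : 𝓧 × 𝓨 → 𝓧 × 𝓨 → ℝ≥0∞) (Y2 : Set 𝓨) {M : ℕ}
    (w : Fin (M + 1) → 𝓧) (j : 𝓨) : ℝ≥0∞ :=
  Set.indicator Y2 (fun j' => pxD q w j') j / normC q Y2 w

/-- The matrix `U[x_{1:n}](i,j)`; a version of `P(Y_r = j | X_{1:n} = x_{1:n}, Y_1 = i)`. -/
noncomputable def UMat (q : 𝓧 × 𝓨 → 𝓧 × 𝓨 → ℝ≥0∞) (Y2 : Set 𝓨) {L R : ℕ} (hR : R ≤ L)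
    (x : Fin (L + 1) → 𝓧) (i j : 𝓨) : ℝ≥0∞ :=
  if 0 < pxD q x i then pmidD q x i ⟨R, by omega⟩ j / pxD q x i
  else lamD q Y2 (segv x R L hR (le_refl L)) j

/-! ### Total variation of measures, conditional laws of `Y_{t:∞}` -/

open Classical in
/-- Total variation distance between two measures (normalized as in the paper:
`‖P − Q‖_TV = 2 sup_A |P(A) − Q(A)|`). -/
noncomputable def tvDistM {W : Type*} [MeasurableSpace W] (ρ₁ ρ₂ : Measure W) : ℝ≥0∞ :=
  2 * ⨆ (A : Set W) (_ : MeasurableSet A), ((ρ₁ A - ρ₂ A) ⊔ (ρ₂ A - ρ₁ A))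

/-- The observation vector `X_{l:n}`. -/
def obsVec (Z : ℕ → Ω → 𝓧 × 𝓨) (l n : ℕ) (ω : Ω) : Fin (n + 1 - l) → 𝓧 :=
  fun i => (Z (l + (i : ℕ)) ω).1

/-- The tail signal process `Y_{t:∞}`. -/
def tailY (Z : ℕ → Ω → 𝓧 × 𝓨) (t : ℕ) (ω : Ω) : ℕ → 𝓨 :=
  fun k => (Z (t + k) ω).2

/-- The observation tail `X_{l:∞}`. -/
def obsTail (Z : ℕ → Ω → 𝓧 × 𝓨) (l : ℕ) (ω : Ω) : ℕ → 𝓧 :=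
  fun k => (Z (l + k) ω).1

/-- A regular version of the conditional distribution `P(Y_{t:∞} ∈ · | X_{l:n})`,
evaluated at `ω`. -/
noncomputable def condLawTail (P : Measure Ω) [IsFiniteMeasure P] (Z : ℕ → Ω → 𝓧 × 𝓨)
    (t l n : ℕ) (ω : Ω) : Measure (ℕ → 𝓨) :=
  condDistrib (tailY Z t) (obsVec Z l n) P (obsVec Z l n ω)

/-- A regular version of the conditional distribution `P(Y_{t:∞} ∈ · | X_{l:∞})`,
evaluated at `ω`. -/
noncomputable def condLawTailInf (P : Measure Ω) [IsFiniteMeasure P] (Z : ℕ → Ω → 𝓧 × 𝓨)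
    (t l : ℕ) (ω : Ω) : Measure (ℕ → 𝓨) :=
  condDistrib (tailY Z t) (obsTail Z l) P (obsTail Z l ω)

/-! ### Hidden Markov models and matrices -/

/-- Powers of a nonnegative matrix on `𝓨`. -/
noncomputable def matpow (p : 𝓨 → 𝓨 → ℝ≥0∞) : ℕ → 𝓨 → 𝓨 → ℝ≥0∞
  | 0 => fun i j => if i = j then 1 else 0
  | n + 1 => fun i j => ∑ k : 𝓨, matpow p n i k * p k j

/-- The sub-matrix `ℙ_C` of `p` with rows and columns restricted to `C` (and `0` outside). -/
noncomputable def subMat (p : 𝓨 → 𝓨 → ℝ≥0∞) (C : Set 𝓨) : 𝓨 → 𝓨 → ℝ≥0∞ :=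
  fun i j => Set.indicator (C ×ˢ C) (fun ij : 𝓨 × 𝓨 => p ij.1 ij.2) (i, j)

/-- Support `G_i = {x : f_i(x) > 0}` of the emission density `f_i`. -/
def emisSupp (f : 𝓨 → 𝓧 → ℝ≥0∞) (i : 𝓨) : Set 𝓧 :=
  {x | 0 < f i x}

/-- `C` is a cluster: `μ[(∩_{i∈C} G_i) \ (∪_{i∉C} G_i)] > 0`. -/
def IsCluster (μ : Measure 𝓧) (f : 𝓨 → 𝓧 → ℝ≥0∞) (C : Set 𝓨) : Prop :=
  0 < μ ((⋂ i ∈ C, emisSupp f i) \ (⋃ i ∈ Cᶜ, emisSupp f i))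

section MarkovExt

variable {S : Type*} [MeasurableSpace S]

/-- The history σ-algebra up to time `n`. -/
@[reducible] def hist (Z : ℕ → Ω → S) (n : ℕ) : MeasurableSpace Ω :=
  ⨆ i ∈ Set.Iic n, MeasurableSpace.comap (Z i) inferInstance

lemma hist_le {Z : ℕ → Ω → S} (hZ : ∀ k, Measurable (Z k)) (n : ℕ) :
    hist Z n ≤ (inferInstance : MeasurableSpace Ω) :=
  iSup₂_le fun i _ => (hZ i).comap_le

lemma hist_mono (Z : ℕ → Ω → S) {a b : ℕ} (h : a ≤ b) : hist Z a ≤ hist Z b :=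
  iSup₂_le fun i hi => le_iSup₂_of_le (f := fun i (_ : i ∈ Set.Iic b) =>
    MeasurableSpace.comap (Z i) inferInstance) i (le_trans hi h) le_rfl

lemma measurable_hist (Z : ℕ → Ω → S) {i n : ℕ} (h : i ≤ n) : Measurable[hist Z n] (Z i) := by
  rw [measurable_iff_comap_le]
  exact le_iSup₂_of_le (f := fun i (_ : i ∈ Set.Iic n) =>
    MeasurableSpace.comap (Z i) inferInstance) i h le_rfl

lemma markov_ext {P : Measure Ω} [IsFiniteMeasure P] {Z : ℕ → Ω → S} {κ : Kernel S S}
    [IsMarkovKernel κ] (h : IsMarkovChain P Z κ) (N : ℕ) {C : Set Ω}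
    (hC : MeasurableSet[hist Z N] C) {W : Type*} [MeasurableSpace W] {T : Ω → W}
    (hT : Measurable[hist Z N] T) {g : W × S → ℝ≥0∞} (hg : Measurable g) :
    ∫⁻ ω in C, g (T ω, Z (N + 1) ω) ∂P = ∫⁻ ω in C, ∫⁻ z', g (T ω, z') ∂(κ (Z N ω)) ∂P := by
  have hle := hist_le h.1 N
  have hT' : Measurable T := hT.mono hle le_rfl
  have hC' : MeasurableSet C := hle _ hC
  let κ' : Kernel Ω S := κ.comap (Z N) (h.1 N)
  have key : (P.restrict C).map (fun ω => (T ω, Z (N + 1) ω)) =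
      ((P.restrict C).compProd κ').map (Prod.map T id) := by
    have hm1 : Measurable (fun ω => (T ω, Z (N + 1) ω)) := hT'.prodMk (h.1 _)
    have hm2 : Measurable (Prod.map T (id : S → S)) := hT'.prodMap measurable_id
    apply Measure.ext_prod
    intro A B hA hB
    have hTA : MeasurableSet[hist Z N] (C ∩ T ⁻¹' A) :=
      MeasurableSet.inter hC (hT hA)
    have h2 := h.2 N (B.indicator 1) (measurable_one.indicator hB) _ hTA
    rw [Measure.map_apply hm1 (hA.prod hB), Measure.map_apply hm2 (hA.prod hB)]
    have e2 : Prod.map T (id : S → S) ⁻¹' (A ×ˢ B) = (T ⁻¹' A) ×ˢ B := by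
      ext; simp
    rw [e2, Measure.compProd_apply_prod (hT' hA) hB, Measure.restrict_restrict (hT' hA)]
    have e1 : (fun ω => (T ω, Z (N + 1) ω)) ⁻¹' (A ×ˢ B) = T ⁻¹' A ∩ (Z (N+1)) ⁻¹' B := by
      ext; simp
    rw [e1, Measure.restrict_apply ((hT' hA).inter (h.1 _ hB))]
    rw [Set.inter_comm (T ⁻¹' A) C]
    have e3 : ∀ ω, κ' ω B = ∫⁻ z', B.indicator 1 z' ∂(κ (Z N ω)) := by
      intro ω
      rw [lintegral_indicator_one hB]; rfl
    simp_rw [e3]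
    rw [← h2]
    have e4 : ∀ ω, B.indicator (1 : S → ℝ≥0∞) (Z (N+1) ω) =
        (Z (N+1) ⁻¹' B).indicator (1 : Ω → ℝ≥0∞) ω := fun ω => rfl
    simp_rw [e4]
    rw [lintegral_indicator_one (h.1 _ hB), Measure.restrict_apply (h.1 _ hB)]
    congr 1
    ext ω; simp; tauto
  calc ∫⁻ ω in C, g (T ω, Z (N + 1) ω) ∂P
      = ∫⁻ p, g p ∂((P.restrict C).map (fun ω => (T ω, Z (N + 1) ω))) := by
        rw [lintegral_map hg (hT'.prodMk (h.1 _))]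
    _ = ∫⁻ ω in C, ∫⁻ z', g (T ω, z') ∂(κ (Z N ω)) ∂P := by
        rw [key, lintegral_map hg (hT'.prodMap measurable_id),
          Measure.lintegral_compProd (f := fun a => g (Prod.map T id a))
            (hg.comp (hT'.prodMap measurable_id))]
        rfl

/-- integrate out the coordinate `N+1`. -/
noncomputable def Kop (κ : Kernel S S) (N : ℕ) (F : (ℕ → S) → ℝ≥0∞) (z : ℕ → S) : ℝ≥0∞ :=
  ∫⁻ z', F (Function.update z (N + 1) z') ∂(κ (z N))

lemma measurable_Kop (κ : Kernel S S) [IsMarkovKernel κ] (N : ℕ) {F : (ℕ → S) → ℝ≥0∞}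
    (hF : Measurable F) : Measurable (Kop κ N F) := by
  have h1 : Measurable (fun p : (ℕ → S) × S => F (Function.update p.1 (N+1) p.2)) :=
    hF.comp measurable_update'
  exact Measurable.lintegral_kernel_prod_right
    (κ := κ.comap (fun z : ℕ → S => z N) (measurable_pi_apply N)) h1

/-- path of the process -/
def pth (Z : ℕ → Ω → S) (ω : Ω) : ℕ → S := fun k => Z k ω

lemma markov_Kop {P : Measure Ω} [IsFiniteMeasure P] {Z : ℕ → Ω → S} {κ : Kernel S S}
    [IsMarkovKernel κ] (h : IsMarkovChain P Z κ) (N : ℕ) {C : Set Ω}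
    (hC : MeasurableSet[hist Z N] C) {F : (ℕ → S) → ℝ≥0∞} (hF : Measurable F)
    (hd : DependsOn F (Set.Iic (N + 1))) :
    ∫⁻ ω in C, F (pth Z ω) ∂P = ∫⁻ ω in C, Kop κ N F (pth Z ω) ∂P := by
  by_cases hS : Nonempty Ω
  swap
  · rw [not_nonempty_iff] at hS
    simp
  obtain ⟨ω0⟩ := hS
  let s0 := Z 0 ω0
  let T : Ω → (ℕ → S) := fun ω k => if k ≤ N then Z k ω else s0
  have hT : Measurable[hist Z N] T := by
    refine @measurable_pi_lambda _ _ _ (_) _ _ (fun k => ?_)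
    by_cases hk : k ≤ N
    · simpa [T, hk] using measurable_hist Z hk
    · simp only [T, hk, if_false]; exact @measurable_const _ _ _ (_) _
  have h1 : Measurable (fun p : (ℕ → S) × S => F (Function.update p.1 (N+1) p.2)) :=
    hF.comp measurable_update'
  have h2 := markov_ext h N hC hT h1
  have e1 : ∀ ω z', F (Function.update (T ω) (N+1) z') =
      F (Function.update (pth Z ω) (N+1) z') := by
    intro ω z'
    apply hd
    intro i hi
    by_cases hi' : i = N + 1
    · subst hi'; simp
    · have : i ≤ N := by simp at hi; omega
      simp [Function.update_of_ne hi', T, this, pth]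
  simp only [e1] at h2
  have e2 : ∀ ω, Function.update (pth Z ω) (N+1) (Z (N+1) ω) = pth Z ω := by
    intro ω
    exact Function.update_eq_self (N+1) (pth Z ω)
  simp only [e2] at h2
  exact h2

/-- avoidance probabilities -/
noncomputable def avoid (κ : Kernel S S) (A : Set S) : ℕ → S → ℝ≥0∞
  | 0 => fun _ => 1
  | n + 1 => fun z => ∫⁻ z', Aᶜ.indicator (avoid κ A n) z' ∂(κ z)

lemma measurable_avoid (κ : Kernel S S) {A : Set S} (hA : MeasurableSet A) (n : ℕ) :
    Measurable (avoid κ A n) := by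
  induction n with
  | zero => exact measurable_const
  | succ n ih => exact (ih.indicator hA.compl).lintegral_kernel

lemma avoid_le_one (κ : Kernel S S) [IsMarkovKernel κ] (A : Set S) (n : ℕ) (z : S) :
    avoid κ A n z ≤ 1 := by
  induction n generalizing z with
  | zero => exact le_rfl
  | succ n ih =>
    calc avoid κ A (n+1) z ≤ ∫⁻ _, 1 ∂(κ z) := lintegral_mono fun z' =>
          (Set.indicator_le_self' (by simp) _).trans (ih z')
      _ = 1 := by simp

lemma prob_avoid {P : Measure Ω} {Z : ℕ → Ω → S} {κ : Kernel S S}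
    (h : IsMarkovChain P Z κ) {A : Set S} (hA : MeasurableSet A) (n : ℕ) :
    ∀ (N : ℕ) (C : Set Ω), MeasurableSet[hist Z N] C →
    P (C ∩ {ω | ∀ k < n, Z (N + 1 + k) ω ∉ A}) = ∫⁻ ω in C, avoid κ A n (Z N ω) ∂P := by
  induction n with
  | zero => intro N C hC; simp [avoid]
  | succ n ih =>
    intro N C hC
    have hle := hist_le h.1 N
    have hC' : MeasurableSet C := hle _ hC
    have hB : MeasurableSet[hist Z (N+1)] (Z (N+1) ⁻¹' Aᶜ) :=
      measurable_hist Z le_rfl hA.compl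
    have h1 := ih (N+1) (C ∩ Z (N+1) ⁻¹' Aᶜ)
      (MeasurableSet.inter (hist_mono Z (Nat.le_succ N) _ hC) hB)
    have e : C ∩ {ω | ∀ k < n + 1, Z (N + 1 + k) ω ∉ A} =
        (C ∩ Z (N+1) ⁻¹' Aᶜ) ∩ {ω | ∀ k < n, Z (N + 1 + 1 + k) ω ∉ A} := by
      ext ω
      simp only [Set.mem_inter_iff, Set.mem_ofPred_eq, Set.mem_preimage, Set.mem_compl_iff]
      constructor
      · rintro ⟨h1, h2⟩
        refine ⟨⟨h1, h2 0 (by omega)⟩, fun k hk => ?_⟩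
        have := h2 (k+1) (by omega)
        rwa [show N + 1 + (k+1) = N + 1 + 1 + k by ring] at this
      · rintro ⟨⟨h1, h2⟩, h3⟩
        refine ⟨h1, fun k hk => ?_⟩
        cases k with
        | zero => exact h2
        | succ k =>
          have := h3 k (by omega)
          rwa [show N + 1 + (k+1) = N + 1 + 1 + k by ring]
    rw [e, h1]
    have h2 := h.2 N (Aᶜ.indicator (avoid κ A n))
      ((measurable_avoid κ hA n).indicator hA.compl) C hC
    rw [show (fun ω => avoid κ A (n+1) (Z N ω)) = fun ω =>
      ∫⁻ z', Aᶜ.indicator (avoid κ A n) z' ∂(κ (Z N ω)) from rfl, ← h2]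
    have hm : MeasurableSet (Z (N+1) ⁻¹' Aᶜ) := h.1 _ hA.compl
    rw [Set.inter_comm, ← Measure.restrict_restrict hm, ← lintegral_indicator hm]
    rfl

lemma family_chain {κ : Kernel S S} {Pz : S → Measure (ℕ → S)} (hF : IsMarkovFamily κ Pz)
    (z : S) : IsMarkovChain (Pz z) (fun k (ω : ℕ → S) => ω k) κ :=
  ⟨fun k => measurable_pi_apply k, fun n g hg C hC => hF.2.2 z n g hg C hC⟩

lemma family_start [MeasurableSingletonClass S] {κ : Kernel S S} {Pz : S → Measure (ℕ → S)}
    (hF : IsMarkovFamily κ Pz) (z : S) : ∀ᵐ ω ∂(Pz z), ω 0 = z := by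
  have := hF.1 z
  have hm : MeasurableSet {ω : ℕ → S | ω 0 = z} :=
    measurable_pi_apply (X := fun _ : ℕ => S) 0 (measurableSet_singleton z)
  rw [ae_iff]
  exact (prob_compl_eq_zero_iff hm).2 (hF.2.1 z)

lemma family_markov [MeasurableSingletonClass S] {κ : Kernel S S} {Pz : S → Measure (ℕ → S)}
    (hF : IsMarkovFamily κ Pz) : IsMarkovKernel κ := by
  constructor
  intro z
  constructor
  have := hF.1 z
  have h := hF.2.2 z 0 (fun _ => 1) measurable_const Set.univ MeasurableSet.univ
  have h0 : ∀ᵐ ω ∂(Pz z), κ (ω 0) Set.univ = κ z Set.univ := by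
    filter_upwards [family_start hF z] with ω hω using by rw [hω]
  simp only [Measure.restrict_univ, lintegral_const, one_mul, measure_univ] at h
  rw [lintegral_congr_ae h0] at h
  simpa using h.symm

lemma avoid_tendsto [MeasurableSingletonClass S] {κ : Kernel S S} {Pz : S → Measure (ℕ → S)}
    {ψ : Measure S} (hF : IsMarkovFamily κ Pz) (hH : HarrisProp κ Pz ψ) {A : Set S}
    (hA : MeasurableSet A) (hψ : 0 < ψ A) (z : S) :
    Filter.Tendsto (fun n => avoid κ A n z) Filter.atTop (nhds 0) := by
  have hp := hF.1 z
  have hc := family_chain hF z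
  let B : ℕ → Set (ℕ → S) := fun n => {ω | ∀ k < n, ω (0 + 1 + k) ∉ A}
  have hB : ∀ n, MeasurableSet (B n) := by
    intro n
    have : B n = ⋂ k, ⋂ (_ : k < n), (fun ω : ℕ → S => ω (0+1+k)) ⁻¹' Aᶜ := by
      ext ω; simp [B]
    rw [this]
    exact MeasurableSet.iInter fun k => MeasurableSet.iInter fun _ =>
      measurable_pi_apply (X := fun _ : ℕ => S) _ hA.compl
  have e : ∀ n, Pz z (B n) = avoid κ A n z := by
    intro n
    have h1 := prob_avoid hc hA n 0 Set.univ MeasurableSet.univ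
    simp only [Set.univ_inter, Measure.restrict_univ] at h1
    rw [show Pz z (B n) = _ from h1]
    have h0 : ∀ᵐ ω ∂(Pz z), avoid κ A n (ω 0) = avoid κ A n z := by
      filter_upwards [family_start hF z] with ω hω using by rw [hω]
    rw [lintegral_congr_ae h0]; simp
  have ht : Filter.Tendsto (fun n => Pz z (B n)) Filter.atTop (nhds (Pz z (⋂ n, B n))) := by
    apply tendsto_measure_iInter_atTop (fun n => (hB n).nullMeasurableSet)
    · intro a b hab ω hω k hk
      exact hω k (lt_of_lt_of_le hk hab)
    · exact ⟨0, measure_ne_top _ _⟩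
  have h0 : Pz z (⋂ n, B n) = 0 := by
    have h1 := hH A hA hψ z
    have hm : MeasurableSet {ω : ℕ → S | ∀ N : ℕ, ∃ k : ℕ, N ≤ k ∧ ω k ∈ A} := by
      have : {ω : ℕ → S | ∀ N : ℕ, ∃ k : ℕ, N ≤ k ∧ ω k ∈ A} =
        ⋂ N, ⋃ k, ⋃ (_ : N ≤ k), (fun ω : ℕ → S => ω k) ⁻¹' A := by ext ω; simp
      rw [this]
      exact MeasurableSet.iInter fun N => MeasurableSet.iUnion fun k => MeasurableSet.iUnion
        fun _ => measurable_pi_apply (X := fun _ : ℕ => S) _ hA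
    have h2 := (prob_compl_eq_zero_iff hm).2 h1
    refine measure_mono_null ?_ h2
    intro ω hω hω'
    obtain ⟨k, hk, hkA⟩ := hω' 1
    simp only [Set.mem_iInter] at hω
    have := hω k (k-1) (by omega)
    rw [show 0 + 1 + (k-1) = k by omega] at this
    exact this hkA
  rw [h0] at ht
  simpa only [e] using ht

lemma chain_io [MeasurableSingletonClass S] {κ : Kernel S S} {Pz : S → Measure (ℕ → S)}
    {ψ : Measure S} (hF : IsMarkovFamily κ Pz) (hH : HarrisProp κ Pz ψ) {A : Set S}
    (hA : MeasurableSet A) (hψ : 0 < ψ A) {P : Measure Ω} [IsProbabilityMeasure P]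
    {Z : ℕ → Ω → S} (h : IsMarkovChain P Z κ) :
    ∀ᵐ ω ∂P, ∀ N, ∃ k, N ≤ k ∧ Z k ω ∈ A := by
  have := family_markov hF
  rw [ae_all_iff]
  intro N
  have ht : Filter.Tendsto (fun n => ∫⁻ ω, avoid κ A n (Z N ω) ∂P) Filter.atTop
      (nhds (∫⁻ _, 0 ∂P)) := by
    apply tendsto_lintegral_of_dominated_convergence (fun _ => 1)
    · exact fun n => (measurable_avoid κ hA n).comp (h.1 N)
    · exact fun n => ae_of_all _ fun ω => avoid_le_one κ A n _
    · simp
    · exact ae_of_all _ fun ω => avoid_tendsto hF hH hA hψ _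
  rw [ae_iff]
  have hb : ∀ n, P {ω | ¬ ∃ k, N ≤ k ∧ Z k ω ∈ A} ≤ ∫⁻ ω, avoid κ A n (Z N ω) ∂P := by
    intro n
    have h1 := prob_avoid h hA n N Set.univ MeasurableSet.univ
    simp only [Set.univ_inter, Measure.restrict_univ] at h1
    rw [← h1]
    apply measure_mono
    intro ω hω k _ hk
    exact hω ⟨_, by omega, hk⟩
  have := ge_of_tendsto' ht hb
  simpa using this

end MarkovExt

section Density

/-- The observation path. -/
def xp (Z : ℕ → Ω → 𝓧 × 𝓨) (ω : Ω) : ℕ → 𝓧 := fun k => (Z k ω).1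

lemma measurable_xp {Z : ℕ → Ω → 𝓧 × 𝓨} (hZ : ∀ k, Measurable (Z k)) : Measurable (xp Z) :=
  measurable_pi_lambda _ fun k => (hZ k).fst

/-- transition density along the path `x` from time `N` to `N + k`. -/
noncomputable def bet (q : 𝓧 × 𝓨 → 𝓧 × 𝓨 → ℝ≥0∞) (N : ℕ) :
    ℕ → 𝓨 → (ℕ → 𝓧) → 𝓨 → ℝ≥0∞
  | 0 => fun i _ j => if i = j then 1 else 0
  | k + 1 => fun i x j =>
      ∑ i' : 𝓨, bet q N k i x i' * q (x (N + k + 1), j) (x (N + k), i')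

/-- joint density of `X_{0:t}, Y_t`. -/
noncomputable def alp (p0 : 𝓧 × 𝓨 → ℝ≥0∞) (q : 𝓧 × 𝓨 → 𝓧 × 𝓨 → ℝ≥0∞) :
    ℕ → (ℕ → 𝓧) → 𝓨 → ℝ≥0∞
  | 0 => fun x j => p0 (x 0, j)
  | t + 1 => fun x j =>
      ∑ i : 𝓨, alp p0 q t x i * q (x (t + 1), j) (x t, i)

lemma measurable_q {q : 𝓧 × 𝓨 → 𝓧 × 𝓨 → ℝ≥0∞} (hq : Measurable (Function.uncurry q))
    {W : Type*} [MeasurableSpace W] {f g : W → 𝓧 × 𝓨} (hf : Measurable f) (hg : Measurable g) :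
    Measurable (fun w => q (f w) (g w)) :=
  hq.comp (hf.prodMk hg)

lemma measurable_bet {q : 𝓧 × 𝓨 → 𝓧 × 𝓨 → ℝ≥0∞} (hq : Measurable (Function.uncurry q))
    (N k : ℕ) (i j : 𝓨) : Measurable (fun x => bet q N k i x j) := by
  induction k generalizing j with
  | zero => exact measurable_const
  | succ k ih =>
    refine Finset.measurable_sum _ fun i' _ => (ih i').mul (measurable_q hq ?_ ?_)
    · exact (measurable_pi_apply _).prodMk measurable_const
    · exact (measurable_pi_apply _).prodMk measurable_const

lemma measurable_alp {q : 𝓧 × 𝓨 → 𝓧 × 𝓨 → ℝ≥0∞} (hq : Measurable (Function.uncurry q))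
    {p0 : 𝓧 × 𝓨 → ℝ≥0∞} (hp : Measurable p0)
    (t : ℕ) (j : 𝓨) : Measurable (fun x => alp p0 q t x j) := by
  induction t generalizing j with
  | zero => exact hp.comp ((measurable_pi_apply _).prodMk measurable_const)
  | succ k ih =>
    refine Finset.measurable_sum _ fun i' _ => (ih i').mul (measurable_q hq ?_ ?_)
    · exact (measurable_pi_apply _).prodMk measurable_const
    · exact (measurable_pi_apply _).prodMk measurable_const

lemma bet_dep (q : 𝓧 × 𝓨 → 𝓧 × 𝓨 → ℝ≥0∞) (N k : ℕ) (i j : 𝓨) :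
    DependsOn (fun x => bet q N k i x j) (Set.Icc N (N + k)) := by
  induction k generalizing j with
  | zero => intro x y _; rfl
  | succ k ih =>
    intro x y h
    simp only [bet]
    rw [h (N + k + 1) (by simp; omega), h (N + k) (by simp)]
    refine Finset.sum_congr rfl fun i' _ => ?_
    rw [show bet q N k i x i' = bet q N k i y i' from
      ih i' fun a ha => h a ⟨ha.1, ha.2.trans (by omega)⟩]

lemma alp_dep (p0 : 𝓧 × 𝓨 → ℝ≥0∞) (q : 𝓧 × 𝓨 → 𝓧 × 𝓨 → ℝ≥0∞) (t : ℕ) (j : 𝓨) :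
    DependsOn (fun x => alp p0 q t x j) (Set.Iic t) := by
  induction t generalizing j with
  | zero => intro x y h; simp only [alp]; rw [h 0 (by simp)]
  | succ k ih =>
    intro x y h
    simp only [alp]
    rw [h (k + 1) (by simp), h k (by simp)]
    refine Finset.sum_congr rfl fun i' _ => ?_
    rw [show alp p0 q k x i' = alp p0 q k y i' from
      ih i' fun a ha => h a (by simp at ha ⊢; omega)]

lemma alp_bet (p0 : 𝓧 × 𝓨 → ℝ≥0∞) (q : 𝓧 × 𝓨 → 𝓧 × 𝓨 → ℝ≥0∞) (t k : ℕ) (x : ℕ → 𝓧)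
    (j : 𝓨) : alp p0 q (t + k) x j = ∑ i, alp p0 q t x i * bet q t k i x j := by
  induction k generalizing j with
  | zero => simp [bet]
  | succ k ih =>
    rw [← add_assoc]
    simp only [alp, bet, ih, Finset.sum_mul, Finset.mul_sum]
    rw [Finset.sum_comm]
    simp only [mul_assoc]

lemma lmarg_sum {ι : Type*} (μ : Measure 𝓧) (s : Finset ℕ) (J : Finset ι)
    {f : ι → (ℕ → 𝓧) → ℝ≥0∞} (hf : ∀ i, Measurable (f i)) (x : ℕ → 𝓧) :
    lmarginal (fun _ => μ) s (fun x => ∑ i ∈ J, f i x) x =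
      ∑ i ∈ J, lmarginal (fun _ => μ) s (f i) x := by
  simp only [lmarginal]
  exact lintegral_finsetSum _ fun i _ => (hf i).comp measurable_updateFinset

lemma lmarg_mul (μ : Measure 𝓧) (s : Finset ℕ) {f g : (ℕ → 𝓧) → ℝ≥0∞}
    (hf : Measurable f) (hg : DependsOn g ((s : Set ℕ)ᶜ)) (x : ℕ → 𝓧) :
    lmarginal (fun _ => μ) s (fun x => g x * f x) x = g x * lmarginal (fun _ => μ) s f x := by
  simp only [lmarginal]
  rw [← lintegral_const_mul (f := fun y => f (Function.updateFinset x s y)) _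
    (hf.comp measurable_updateFinset)]
  refine lintegral_congr fun y => ?_
  congr 1
  apply hg
  intro i hi
  simp only [Set.mem_compl_iff, Finset.mem_coe] at hi
  simp [Function.updateFinset, hi]

lemma lmarg_dep (μ : Measure 𝓧) (s : Finset ℕ) {f : (ℕ → 𝓧) → ℝ≥0∞} {D : Set ℕ}
    (hf : DependsOn f D) : DependsOn (lmarginal (fun _ => μ) s f) (D \ s) := by
  intro x y h
  simp only [lmarginal]
  refine lintegral_congr fun u => hf fun i hi => ?_
  by_cases hs : i ∈ s
  · simp [Function.updateFinset, hs]
  · simp [Function.updateFinset, hs, h i ⟨hi, by simpa using hs⟩]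

lemma lintegral_dens {κ : Kernel (𝓧 × 𝓨) (𝓧 × 𝓨)} {μ : Measure 𝓧} [SigmaFinite μ]
    {ρ : Measure (𝓧 × 𝓨)} {d : 𝓧 × 𝓨 → ℝ≥0∞} (hd : Measurable d)
    (hρ : ρ = (μ.prod Measure.count).withDensity d)
    {h : 𝓧 × 𝓨 → ℝ≥0∞} (hh : Measurable h) :
    ∫⁻ z, h z ∂ρ = ∑ j, ∫⁻ x, h (x, j) * d (x, j) ∂μ := by
  rw [hρ, lintegral_withDensity_eq_lintegral_mul _ hd hh,
    lintegral_prod_symm _ (hd.mul hh).aemeasurable, lintegral_count, tsum_fintype]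
  simp [mul_comm]

/-- one step integration -/
noncomputable def stepf (μ : Measure 𝓧) (q : 𝓧 × 𝓨 → 𝓧 × 𝓨 → ℝ≥0∞) (n : ℕ)
    (f : (ℕ → 𝓧) → 𝓨 → ℝ≥0∞) (x : ℕ → 𝓧) (i : 𝓨) : ℝ≥0∞ :=
  ∑ j, ∫⁻ x', f (Function.update x (n + 1) x') j * q (x', j) (x n, i) ∂μ

lemma measurable_stepf_aux {μ : Measure 𝓧} [SigmaFinite μ] {q : 𝓧 × 𝓨 → 𝓧 × 𝓨 → ℝ≥0∞}
    (hq : Measurable (Function.uncurry q)) (n : ℕ) {f : (ℕ → 𝓧) → 𝓨 → ℝ≥0∞}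
    (hf : ∀ j, Measurable (fun x => f x j)) (i j : 𝓨) :
    Measurable (fun x => ∫⁻ x', f (Function.update x (n + 1) x') j * q (x', j) (x n, i) ∂μ) := by
  refine Measurable.lintegral_prod_right'
    (f := fun p : (ℕ → 𝓧) × 𝓧 => f (Function.update p.1 (n+1) p.2) j * q (p.2, j) (p.1 n, i)) ?_
  refine ((hf j).comp measurable_update').mul (measurable_q hq ?_ ?_)
  · exact measurable_snd.prodMk measurable_const
  · exact ((measurable_pi_apply n).comp measurable_fst).prodMk measurable_const

lemma step_pointwise {μ : Measure 𝓧} [SigmaFinite μ] {q : 𝓧 × 𝓨 → 𝓧 × 𝓨 → ℝ≥0∞}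
    (hq : Measurable (Function.uncurry q)) (N k : ℕ) {f : (ℕ → 𝓧) → 𝓨 → ℝ≥0∞}
    (hf : ∀ j, Measurable (fun x => f x j)) (i : 𝓨) (x : ℕ → 𝓧) :
    ∑ i', lmarginal (fun _ => μ) (Finset.Ioc N (N + k))
        (fun x => stepf μ q (N + k) f x i' * bet q N k i x i') x =
      ∑ j, lmarginal (fun _ => μ) (Finset.Ioc N (N + (k + 1)))
        (fun x => f x j * bet q N (k + 1) i x j) x := by
  have hins : Finset.Ioc N (N + (k + 1)) = insert (N + k + 1) (Finset.Ioc N (N + k)) := by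
    ext a; simp; omega
  have hm : ∀ j, Measurable (fun x => f x j * bet q N (k + 1) i x j) := fun j =>
    (hf j).mul (measurable_bet hq _ _ _ _)
  rw [← lmarg_sum, hins]
  swap
  · intro i'
    exact (Finset.measurable_sum _ fun j _ => measurable_stepf_aux hq _ hf i' j).mul
      (measurable_bet hq _ _ _ _)
  have e : ∀ j, lmarginal (fun _ => μ) (insert (N + k + 1) (Finset.Ioc N (N + k)))
        (fun x => f x j * bet q N (k + 1) i x j) x = lmarginal (fun _ => μ) (Finset.Ioc N (N + k))
        (fun x => ∑ i', (∫⁻ x', f (Function.update x (N + k + 1) x') j *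
          q (x', j) (x (N + k), i') ∂μ) * bet q N k i x i') x := by
    intro j
    rw [lmarginal_insert' _ (hm j) (by simp)]
    congr 1
    funext x
    have e1 : ∀ x', f (Function.update x (N + k + 1) x') j *
        bet q N (k + 1) i (Function.update x (N + k + 1) x') j = ∑ i',
          (f (Function.update x (N + k + 1) x') j * q (x', j) (x (N + k), i')) *
            bet q N k i x i' := by
      intro x'
      simp only [bet, Finset.mul_sum]
      refine Finset.sum_congr rfl fun i' _ => ?_
      have : bet q N k i (Function.update x (N + k + 1) x') i' = bet q N k i x i' := by
        refine bet_dep q N k i i' fun a ha => ?_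
        rw [Function.update_of_ne]
        have := ha.2
        omega
      rw [this, Function.update_self, Function.update_of_ne (by omega)]
      ring
    simp_rw [e1]
    have hm' : ∀ i', Measurable (fun x' => f (Function.update x (N + k + 1) x') j *
        q (x', j) (x (N + k), i')) := fun i' =>
      ((hf j).comp (measurable_update x)).mul
        (measurable_q hq (measurable_id.prodMk measurable_const) measurable_const)
    rw [lintegral_finsetSum _ fun i' _ => (hm' i').mul_const _]
    exact Finset.sum_congr rfl fun i' _ => lintegral_mul_const _ (hm' i')
  simp_rw [e]
  rw [← lmarg_sum]
  swap
  · intro j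
    exact Finset.measurable_sum _ fun i' _ => (measurable_stepf_aux hq _ hf i' j).mul
      (measurable_bet hq _ _ _ _)
  congr 1
  funext x
  simp only [stepf, Finset.sum_mul]
  exact Finset.sum_comm

lemma block_formula {P : Measure Ω} [IsFiniteMeasure P] {Z : ℕ → Ω → 𝓧 × 𝓨}
    {κ : Kernel (𝓧 × 𝓨) (𝓧 × 𝓨)} [IsMarkovKernel κ] (h : IsMarkovChain P Z κ)
    {μ : Measure 𝓧} [SigmaFinite μ] {q : 𝓧 × 𝓨 → 𝓧 × 𝓨 → ℝ≥0∞}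
    (hq : Measurable (Function.uncurry q))
    (hκ : ∀ z : 𝓧 × 𝓨, (κ z : Measure (𝓧 × 𝓨)) =
      (μ.prod Measure.count).withDensity (fun z' => q z' z))
    (N : ℕ) {C : Set Ω} (hC : MeasurableSet[hist Z N] C) (k : ℕ) :
    ∀ (f : (ℕ → 𝓧) → 𝓨 → ℝ≥0∞), (∀ j, Measurable (fun x => f x j)) →
    (∀ j, DependsOn (fun x => f x j) (Set.Iic (N + k))) →
    ∫⁻ ω in C, f (xp Z ω) (Z (N + k) ω).2 ∂P =
      ∫⁻ ω in C, ∑ j, lmarginal (fun _ => μ) (Finset.Ioc N (N + k))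
        (fun x => f x j * bet q N k (Z N ω).2 x j) (xp Z ω) ∂P := by
  induction k with
  | zero =>
    intro f hf hd
    simp [bet]
  | succ k ih =>
    intro f hf hd
    let F : (ℕ → 𝓧 × 𝓨) → ℝ≥0∞ := fun z => f (fun a => (z a).1) (z (N + k + 1)).2
    have hF : Measurable F := by
      have h1 : Measurable (fun p : (ℕ → 𝓧) × 𝓨 => f p.1 p.2) :=
        measurable_from_prod_countable_left hf
      exact h1.comp ((measurable_pi_lambda _ fun a => (measurable_pi_apply a).fst).prodMk
        (measurable_pi_apply (N+k+1)).snd)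
    have hFd : DependsOn F (Set.Iic (N + k + 1)) := by
      intro z z' hz
      simp only [F]
      rw [hz (N+k+1) (by simp)]
      exact hd _ fun a ha => by rw [hz a ha]
    have h1 := markov_Kop h (N + k) (hist_mono Z (Nat.le_add_right N k) _ hC) hF hFd
    have h2 : ∀ z, Kop κ (N+k) F z = stepf μ q (N + k) f (fun a => (z a).1) (z (N+k)).2 := by
      intro z
      have hm : Measurable (fun z' => F (Function.update z (N + k + 1) z')) :=
        hF.comp (measurable_update z)
      rw [Kop, lintegral_dens (κ := κ) (measurable_q hq measurable_id measurable_const) (hκ _) hm]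
      refine Finset.sum_congr rfl fun j _ => lintegral_congr fun x' => ?_
      simp only [F, Function.update_self]
      congr 2
      funext a
      by_cases ha : a = N + k + 1
      · subst ha; simp
      · simp [Function.update_of_ne ha]
    simp only [h2] at h1
    have h3 := ih (stepf μ q (N + k) f)
      (fun j => Finset.measurable_sum _ fun j' _ => measurable_stepf_aux hq _ hf j j')
      (by
        intro j x y hxy
        simp only [stepf]
        refine Finset.sum_congr rfl fun j' _ => lintegral_congr fun x' => ?_
        rw [hxy (N+k) (by simp)]
        congr 1
        refine hd j' fun a ha => ?_
        by_cases ha' : a = N + k + 1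
        · subst ha'; simp
        · rw [Function.update_of_ne ha', Function.update_of_ne ha']
          exact hxy a (by simp at ha ⊢; omega))
    calc ∫⁻ ω in C, f (xp Z ω) (Z (N + (k+1)) ω).2 ∂P
        = ∫⁻ ω in C, stepf μ q (N + k) f (xp Z ω) (Z (N + k) ω).2 ∂P := h1
      _ = _ := by
        rw [h3]
        exact lintegral_congr fun ω => step_pointwise hq N k hf _ _

end Density

section Alpha

lemma density_formula {P : Measure Ω} [IsFiniteMeasure P] {Z : ℕ → Ω → 𝓧 × 𝓨}
    {κ : Kernel (𝓧 × 𝓨) (𝓧 × 𝓨)} [IsMarkovKernel κ] (h : IsMarkovChain P Z κ)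
    {μ : Measure 𝓧} [SigmaFinite μ] {q : 𝓧 × 𝓨 → 𝓧 × 𝓨 → ℝ≥0∞}
    (hq : Measurable (Function.uncurry q))
    (hκ : ∀ z : 𝓧 × 𝓨, (κ z : Measure (𝓧 × 𝓨)) =
      (μ.prod Measure.count).withDensity (fun z' => q z' z))
    {p0 : 𝓧 × 𝓨 → ℝ≥0∞} (hp : Measurable p0)
    (h0 : P.map (Z 0) = (μ.prod Measure.count).withDensity p0)
    (t : ℕ) (f : (ℕ → 𝓧) → 𝓨 → ℝ≥0∞) (hf : ∀ j, Measurable (fun x => f x j))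
    (hd : ∀ j, DependsOn (fun x => f x j) (Set.Iic t)) (x : ℕ → 𝓧) :
    ∫⁻ ω, f (xp Z ω) (Z t ω).2 ∂P =
      ∑ j, lmarginal (fun _ => μ) (Finset.range (t + 1))
        (fun x => f x j * alp p0 q t x j) x := by
  have h1 := block_formula h hq hκ 0 (C := Set.univ) MeasurableSet.univ t f hf
    (by simpa using hd)
  simp only [Measure.restrict_univ, zero_add] at h1
  rw [h1]
  let H : 𝓧 × 𝓨 → ℝ≥0∞ := fun z => ∑ j, lmarginal (fun _ => μ) (Finset.Ioc 0 t)
        (fun x => f x j * bet q 0 t z.2 x j) (Function.update x 0 z.1)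
  have hm : ∀ i j, Measurable (fun x => f x j * bet q 0 t i x j) := fun i j =>
    (hf j).mul (measurable_bet hq _ _ _ _)
  have hm2 : ∀ i j, Measurable (fun x' => lmarginal (fun _ => μ) (Finset.Ioc 0 t)
        (fun x => f x j * bet q 0 t i x j) (Function.update x 0 x')) := fun i j =>
    ((hm i j).lmarginal _).comp (measurable_update x)
  have hm3 : ∀ i j, Measurable (fun x' => lmarginal (fun _ => μ) (Finset.Ioc 0 t)
        (fun x => f x j * bet q 0 t i x j) (Function.update x 0 x') * p0 (x', i)) := fun i j =>
    (hm2 i j).mul (hp.comp (measurable_id.prodMk measurable_const))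
  have hH : Measurable H := by
    apply measurable_from_prod_countable_left
    intro i
    exact Finset.measurable_sum _ fun j _ => hm2 i j
  have e1 : ∀ ω, ∑ j, lmarginal (fun _ => μ) (Finset.Ioc 0 t)
        (fun x => f x j * bet q 0 t (Z 0 ω).2 x j) (xp Z ω) = H (Z 0 ω) := by
    intro ω
    refine Finset.sum_congr rfl fun j _ => ?_
    have hdep : DependsOn (fun x => f x j * bet q 0 t (Z 0 ω).2 x j) (Set.Iic t) := by
      intro a b hab
      simp only
      rw [show f a j = f b j from hd j hab, show bet q 0 t (Z 0 ω).2 a j = bet q 0 t (Z 0 ω).2 b j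
        from bet_dep q 0 t _ _ fun i hi => hab i (by simpa using hi.2)]
    refine lmarg_dep μ (Finset.Ioc 0 t) hdep ?_
    intro i hi
    have hi0 : i = 0 := by
      simp at hi; omega
    subst hi0
    simp [xp]
  simp_rw [e1]
  rw [← lintegral_map hH (h.1 0), lintegral_dens (κ := κ) hp h0 hH]
  have e2 : ∀ j, lmarginal (fun _ => μ) (Finset.range (t + 1))
        (fun x => f x j * alp p0 q t x j) x =
      ∑ i, ∫⁻ x', lmarginal (fun _ => μ) (Finset.Ioc 0 t)
        (fun x => f x j * bet q 0 t i x j) (Function.update x 0 x') * p0 (x', i) ∂μ := by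
    intro j
    have hr : Finset.range (t + 1) = insert 0 (Finset.Ioc 0 t) := by
      ext a
      simp only [Finset.mem_range, Finset.mem_insert, Finset.mem_Ioc]
      omega
    have hma : Measurable (fun x => f x j * alp p0 q t x j) :=
      (hf j).mul (measurable_alp hq hp t j)
    rw [hr, lmarginal_insert _ hma (by simp), ← lintegral_finsetSum _ fun i _ => hm3 i j]
    refine lintegral_congr fun x' => ?_
    have e3 : ∀ x, f x j * alp p0 q t x j =
        ∑ i, p0 (x 0, i) * (f x j * bet q 0 t i x j) := by
      intro x
      have := alp_bet p0 q 0 t x j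
      rw [zero_add] at this
      rw [this, Finset.mul_sum]
      refine Finset.sum_congr rfl fun i _ => ?_
      simp only [alp]; ring
    simp_rw [e3]
    have hp' : ∀ i, Measurable (fun x : ℕ → 𝓧 => p0 (x 0, i)) := fun i =>
      hp.comp ((measurable_pi_apply 0).prodMk measurable_const)
    rw [lmarg_sum (f := fun i x => p0 (x 0, i) * (f x j * bet q 0 t i x j)) _ _ _
      fun i => (hp' i).mul (hm i j)]
    refine Finset.sum_congr rfl fun i _ => ?_
    rw [lmarg_mul (g := fun x => p0 (x 0, i)) _ _ (hm i j)]
    · simp [mul_comm]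
    · intro a b hab
      simp only
      rw [hab 0 (by simp)]
  simp_rw [e2]
  rw [Finset.sum_comm]
  refine Finset.sum_congr rfl fun i _ => ?_
  rw [← lintegral_finsetSum _ fun j _ => hm3 i j]
  refine lintegral_congr fun x' => ?_
  simp only [H, Finset.sum_mul]

/-- marginal density of `X_{s:t}, Y_t`. -/
noncomputable def alp' (μ : Measure 𝓧) (p0 : 𝓧 × 𝓨 → ℝ≥0∞) (q : 𝓧 × 𝓨 → 𝓧 × 𝓨 → ℝ≥0∞)
    (s t : ℕ) (x : ℕ → 𝓧) (j : 𝓨) : ℝ≥0∞ :=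
  lmarginal (fun _ => μ) (Finset.range s) (fun x => alp p0 q t x j) x

lemma measurable_alp' {μ : Measure 𝓧} [SigmaFinite μ] {q : 𝓧 × 𝓨 → 𝓧 × 𝓨 → ℝ≥0∞}
    (hq : Measurable (Function.uncurry q))
    {p0 : 𝓧 × 𝓨 → ℝ≥0∞} (hp : Measurable p0)
    (s t : ℕ) (j : 𝓨) : Measurable (fun x => alp' μ p0 q s t x j) :=
  (measurable_alp hq hp t j).lmarginal _

lemma alp'_dep (μ : Measure 𝓧) (p0 : 𝓧 × 𝓨 → ℝ≥0∞) (q : 𝓧 × 𝓨 → 𝓧 × 𝓨 → ℝ≥0∞)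
    (s t : ℕ) (j : 𝓨) : DependsOn (fun x => alp' μ p0 q s t x j) (Set.Icc s t) := by
  have := lmarg_dep μ (Finset.range s) (alp_dep p0 q t j)
  intro x y hxy
  apply this
  intro i hi
  apply hxy
  simp at hi ⊢
  omega

lemma alp'_bet {μ : Measure 𝓧} [SigmaFinite μ] {q : 𝓧 × 𝓨 → 𝓧 × 𝓨 → ℝ≥0∞}
    (hq : Measurable (Function.uncurry q))
    {p0 : 𝓧 × 𝓨 → ℝ≥0∞} (hp : Measurable p0) {s t : ℕ} (hst : s ≤ t) (k : ℕ) (x : ℕ → 𝓧)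
    (j : 𝓨) : alp' μ p0 q s (t + k) x j = ∑ i, alp' μ p0 q s t x i * bet q t k i x j := by
  simp only [alp', alp_bet p0 q t k]
  rw [lmarg_sum (f := fun i x => alp p0 q t x i * bet q t k i x j) _ _ _ fun i => (measurable_alp hq hp t i).mul (measurable_bet hq t k i j)]
  refine Finset.sum_congr rfl fun i _ => ?_
  simp_rw [mul_comm (alp p0 q t _ i)]
  rw [lmarg_mul (g := fun x => bet q t k i x j) _ _ (measurable_alp hq hp t i), mul_comm]
  intro a b hab
  refine bet_dep q t k i j fun c hc => hab c ?_
  have := hc.1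
  simp
  omega

/-- total densities -/
lemma range_split {s t : ℕ} (hst : s ≤ t) :
    Finset.range (t + 1) = Finset.range s ∪ Finset.Icc s t := by
  ext a; simp; omega

lemma range_disj (s t : ℕ) : Disjoint (Finset.range s) (Finset.Icc s t) := by
  rw [Finset.disjoint_left]
  intro a h1 h2
  simp at h1 h2
  omega

lemma lmarg_alp' {μ : Measure 𝓧} [SigmaFinite μ] {q : 𝓧 × 𝓨 → 𝓧 × 𝓨 → ℝ≥0∞}
    (hq : Measurable (Function.uncurry q))
    {p0 : 𝓧 × 𝓨 → ℝ≥0∞} (hp : Measurable p0) {s t : ℕ} (hst : s ≤ t)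
    {g : (ℕ → 𝓧) → ℝ≥0∞} (hg : Measurable g) (hgd : DependsOn g ((Finset.range s : Set ℕ)ᶜ))
    (j : 𝓨) (x : ℕ → 𝓧) :
    lmarginal (fun _ => μ) (Finset.range (t + 1)) (fun x => g x * alp p0 q t x j) x =
    lmarginal (fun _ => μ) (Finset.Icc s t) (fun x => g x * alp' μ p0 q s t x j) x := by
  have hm : Measurable (fun x => g x * alp p0 q t x j) := hg.mul (measurable_alp hq hp t j)
  rw [range_split hst, lmarginal_union' _ _ hm (range_disj s t)]
  congr 1
  funext y
  exact lmarg_mul μ _ (measurable_alp hq hp t j) hgd y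

end Alpha

section Facts

lemma dens {P : Measure Ω} {Z : ℕ → Ω → 𝓧 × 𝓨}
    {κ : Kernel (𝓧 × 𝓨) (𝓧 × 𝓨)} [IsMarkovKernel κ]
    {μ : Measure 𝓧} {q : 𝓧 × 𝓨 → 𝓧 × 𝓨 → ℝ≥0∞} {p0 : 𝓧 × 𝓨 → ℝ≥0∞}
    (hP : IsPMM P Z κ μ q p0)
    (t : ℕ) (f : (ℕ → 𝓧) → 𝓨 → ℝ≥0∞) (hf : ∀ j, Measurable (fun x => f x j))
    (hd : ∀ j, DependsOn (fun x => f x j) (Set.Iic t)) (x : ℕ → 𝓧) :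
    ∫⁻ ω, f (xp Z ω) (Z t ω).2 ∂P =
      ∑ j, lmarginal (fun _ => μ) (Finset.range (t + 1))
        (fun x => f x j * alp p0 q t x j) x := by
  obtain ⟨h1, h2, h3, h4, h5, h6, h7⟩ := hP
  exact density_formula h2 h4 h6 h5 h7 t f hf hd x

lemma alp_pos {P : Measure Ω} {Z : ℕ → Ω → 𝓧 × 𝓨}
    {κ : Kernel (𝓧 × 𝓨) (𝓧 × 𝓨)} [IsMarkovKernel κ]
    {μ : Measure 𝓧} {q : 𝓧 × 𝓨 → 𝓧 × 𝓨 → ℝ≥0∞} {p0 : 𝓧 × 𝓨 → ℝ≥0∞}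
    (hP : IsPMM P Z κ μ q p0) :
    ∀ᵐ ω ∂P, ∀ t, alp p0 q t (xp Z ω) (Z t ω).2 ≠ 0 := by
  rw [ae_all_iff]
  intro t
  have hP' := hP
  obtain ⟨h1, h2, h3, h4, h5, h6, h7⟩ := hP
  obtain ⟨ω0⟩ : Nonempty Ω := nonempty_of_isProbabilityMeasure P
  classical
  let f : (ℕ → 𝓧) → 𝓨 → ℝ≥0∞ := fun x j => if alp p0 q t x j = 0 then 1 else 0
  have hfm : ∀ j, Measurable (fun x => f x j) := fun j =>
    Measurable.ite (measurable_alp h4 h5 t j (measurableSet_singleton 0))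
      measurable_const measurable_const
  have hfm2 : Measurable (fun ω => f (xp Z ω) (Z t ω).2) := by
    have h1 : Measurable (fun p : (ℕ → 𝓧) × 𝓨 => f p.1 p.2) :=
        measurable_from_prod_countable_left hfm
    exact h1.comp ((measurable_xp h2.1).prodMk (h2.1 t).snd)
  have := dens hP' t f hfm
    (by
      intro j a b hab
      simp only [f]
      rw [show alp p0 q t a j = alp p0 q t b j from alp_dep p0 q t j hab])
    (xp Z ω0)
  have e : ∀ j, (fun x => f x j * alp p0 q t x j) = fun x => 0 := by
    intro j; funext x
    by_cases hx : alp p0 q t x j = 0 <;> simp [f, hx]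
  have hz : ∫⁻ ω, f (xp Z ω) (Z t ω).2 ∂P = 0 := by
    rw [this]
    refine Finset.sum_eq_zero fun j _ => ?_
    rw [e]
    simp [lmarginal]
  rw [lintegral_eq_zero_iff hfm2] at hz
  filter_upwards [hz] with ω hω h
  simp [f, h] at hω

lemma alp'_fin {P : Measure Ω} {Z : ℕ → Ω → 𝓧 × 𝓨}
    {κ : Kernel (𝓧 × 𝓨) (𝓧 × 𝓨)} [IsMarkovKernel κ]
    {μ : Measure 𝓧} {q : 𝓧 × 𝓨 → 𝓧 × 𝓨 → ℝ≥0∞} {p0 : 𝓧 × 𝓨 → ℝ≥0∞}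
    (hP : IsPMM P Z κ μ q p0) (s : ℕ) :
    ∀ᵐ ω ∂P, ∀ t, s ≤ t → ∀ i, alp' μ p0 q s t (xp Z ω) i ≠ ⊤ := by
  rw [ae_all_iff]
  intro t
  rw [ae_all_iff]
  intro hst
  rw [ae_all_iff]
  intro i
  have hP' := hP
  obtain ⟨h1, h2, h3, h4, h5, h6, h7⟩ := hP
  obtain ⟨ω0⟩ : Nonempty Ω := nonempty_of_isProbabilityMeasure P
  classical
  let x0 := xp Z ω0
  have hfin : lmarginal (fun _ => μ) (Finset.Icc s t) (fun x => alp' μ p0 q s t x i) x0 ≤ 1 := by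
    have := dens hP' t (fun _ j => if j = i then 1 else 0) (fun j => measurable_const)
      (fun j a b hab => rfl) x0
    have h8 := lmarg_alp' (μ := μ) h4 h5 hst (g := fun _ => 1) measurable_const
      (fun _ _ _ => rfl) i x0
    simp only [one_mul] at h8
    rw [← h8]
    calc _ = lmarginal (fun _ => μ) (Finset.range (t + 1))
              (fun x => (if i = i then 1 else 0) * alp p0 q t x i) x0 := by simp
      _ ≤ ∑ j, lmarginal (fun _ => μ) (Finset.range (t + 1))
        (fun x => (if j = i then 1 else 0) * alp p0 q t x j) x0 :=
          Finset.single_le_sum (f := fun j => lmarginal (fun _ => μ) (Finset.range (t + 1))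
            (fun x => (if j = i then 1 else 0) * alp p0 q t x j) x0)
            (fun _ _ => zero_le) (Finset.mem_univ i)
      _ = ∫⁻ ω, (if (Z t ω).2 = i then 1 else 0) ∂P := this.symm
      _ ≤ ∫⁻ ω, 1 ∂P := lintegral_mono fun ω => by split_ifs <;> simp
      _ = 1 := by simp
  have hm := measurable_alp' (μ := μ) h4 h5 s t i
  have hae : ∀ᵐ u ∂(Measure.pi fun _ : Finset.Icc s t => μ),
      alp' μ p0 q s t (Function.updateFinset x0 (Finset.Icc s t) u) i < ⊤ :=
    ae_lt_top (hm.comp measurable_updateFinset) (ne_top_of_le_ne_top ENNReal.one_ne_top hfin)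
  let g : (ℕ → 𝓧) → ℝ≥0∞ := fun x => if alp' μ p0 q s t x i = ⊤ then 1 else 0
  have hgm : Measurable g := Measurable.ite (hm (measurableSet_singleton ⊤))
      measurable_const measurable_const
  have hgd : DependsOn g (Set.Icc s t) := by
    intro a b hab
    simp only [g]
    rw [show alp' μ p0 q s t a i = alp' μ p0 q s t b i from alp'_dep μ p0 q s t i hab]
  have hz : ∫⁻ ω, g (xp Z ω) ∂P = 0 := by
    rw [dens hP' t (fun x _ => g x) (fun _ => hgm)
      (fun _ a b hab => hgd fun i hi => hab i hi.2) x0]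
    refine Finset.sum_eq_zero fun j _ => ?_
    rw [lmarg_alp' h4 h5 hst hgm
      (fun a b hab => hgd fun i hi => hab i (by have := hi.1; simp; omega))]
    simp only [lmarginal]
    rw [lintegral_eq_zero_iff]
    · filter_upwards [hae] with u hu
      simp [g, hu.ne]
    · exact (hgm.mul (measurable_alp' h4 h5 s t j)).comp measurable_updateFinset
  rw [lintegral_eq_zero_iff (f := fun ω => g (xp Z ω)) (hgm.comp (measurable_xp h2.1))] at hz
  filter_upwards [hz] with ω hω h
  simp [g, h] at hω

lemma alp_fin {P : Measure Ω} {Z : ℕ → Ω → 𝓧 × 𝓨}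
    {κ : Kernel (𝓧 × 𝓨) (𝓧 × 𝓨)} [IsMarkovKernel κ]
    {μ : Measure 𝓧} {q : 𝓧 × 𝓨 → 𝓧 × 𝓨 → ℝ≥0∞} {p0 : 𝓧 × 𝓨 → ℝ≥0∞}
    (hP : IsPMM P Z κ μ q p0) :
    ∀ᵐ ω ∂P, ∀ t, ∀ i, alp p0 q t (xp Z ω) i ≠ ⊤ := by
  filter_upwards [alp'_fin hP 0] with ω hω t i
  simpa [alp'] using hω t (Nat.zero_le _) i

lemma alp'_supp {P : Measure Ω} {Z : ℕ → Ω → 𝓧 × 𝓨}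
    {κ : Kernel (𝓧 × 𝓨) (𝓧 × 𝓨)} [IsMarkovKernel κ]
    {μ : Measure 𝓧} {q : 𝓧 × 𝓨 → 𝓧 × 𝓨 → ℝ≥0∞} {p0 : 𝓧 × 𝓨 → ℝ≥0∞}
    (hP : IsPMM P Z κ μ q p0) (s : ℕ) :
    ∀ᵐ ω ∂P, ∀ i, alp' μ p0 q s s (xp Z ω) i = 0 → alp p0 q s (xp Z ω) i = 0 := by
  rw [ae_all_iff]
  intro i
  have hP' := hP
  obtain ⟨h1, h2, h3, h4, h5, h6, h7⟩ := hP
  obtain ⟨ω0⟩ : Nonempty Ω := nonempty_of_isProbabilityMeasure P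
  classical
  let x0 := xp Z ω0
  have hm := measurable_alp' (μ := μ) h4 h5 s s i
  have hm1 := measurable_alp h4 h5 s i
  let g : (ℕ → 𝓧) → ℝ≥0∞ := fun x =>
    if alp' μ p0 q s s x i = 0 ∧ alp p0 q s x i ≠ 0 then 1 else 0
  have hgm : Measurable g := Measurable.ite ((hm (measurableSet_singleton 0)).inter
      (hm1 (measurableSet_singleton 0)).compl) measurable_const measurable_const
  have hgd : DependsOn g (Set.Iic s) := by
    intro a b hab
    simp only [g]
    rw [show alp' μ p0 q s s a i = alp' μ p0 q s s b i from
      alp'_dep μ p0 q s s i fun i hi => hab i hi.2,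
      show alp p0 q s a i = alp p0 q s b i from alp_dep p0 q s i hab]
  have hz : ∫⁻ ω, g (xp Z ω) ∂P = 0 := by
    rw [dens hP' s (fun x _ => g x) (fun _ => hgm) (fun _ => hgd) x0]
    refine Finset.sum_eq_zero fun j _ => ?_
    have hmm : Measurable (fun x => g x * alp p0 q s x j) := hgm.mul (measurable_alp h4 h5 s j)
    rw [range_split le_rfl, lmarginal_union' _ _ hmm (range_disj s s)]
    have : lmarginal (fun _ => μ) (Finset.range s) (fun x => g x * alp p0 q s x j) =
        fun x => 0 := by
      funext x
      simp only [lmarginal]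
      have hmm2 : Measurable (fun u => g (Function.updateFinset x (Finset.range s) u) *
          alp p0 q s (Function.updateFinset x (Finset.range s) u) j) :=
        hmm.comp measurable_updateFinset
      rw [lintegral_eq_zero_iff hmm2]
      have e : ∀ u, alp' μ p0 q s s (Function.updateFinset x (Finset.range s) u) i =
          alp' μ p0 q s s x i := by
        intro u
        refine alp'_dep μ p0 q s s i fun k hk => ?_
        have : ¬ k < s := not_lt.2 hk.1
        simp [Function.updateFinset, this]
      by_cases hx : alp' μ p0 q s s x i = 0
      · have hx' := hx
        simp only [alp', lmarginal] at hx'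
        have hmm3 : Measurable (fun u => alp p0 q s
            (Function.updateFinset x (Finset.range s) u) i) := hm1.comp measurable_updateFinset
        rw [lintegral_eq_zero_iff hmm3] at hx'
        filter_upwards [hx'] with u hu
        simp only [Pi.zero_apply] at hu
        simp [g, hu]
      · refine ae_of_all _ fun u => ?_
        simp [g, e, hx]
    rw [this]
    simp [lmarginal]
  rw [lintegral_eq_zero_iff (f := fun ω => g (xp Z ω)) (hgm.comp (measurable_xp h2.1))] at hz
  filter_upwards [hz] with ω hω h
  by_contra h'
  simp [g, h, h'] at hω

end Facts

section Splice

/-- replace the first `s` observations by `a`. -/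
def spl (s : ℕ) (a : Finset.range s → 𝓧) (z : ℕ → 𝓧 × 𝓨) (k : ℕ) : 𝓧 × 𝓨 :=
  (Function.updateFinset (fun k => (z k).1) (Finset.range s) a k, (z k).2)

lemma spl_ge {s k : ℕ} (hk : s ≤ k) (a : Finset.range s → 𝓧) (z : ℕ → 𝓧 × 𝓨) :
    spl s a z k = z k := by
  have : ¬ k < s := not_lt.2 hk
  simp [spl, Function.updateFinset, this]

lemma measurable_spl (s : ℕ) :
    Measurable (fun p : (Finset.range s → 𝓧) × (ℕ → 𝓧 × 𝓨) => spl s p.1 p.2) := by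
  refine measurable_pi_lambda _ fun k => ?_
  have h2 : Measurable (fun p : (Finset.range s → 𝓧) × (ℕ → 𝓧 × 𝓨) => p.2 k) :=
    (measurable_pi_apply k).comp measurable_snd
  refine Measurable.prodMk ?_ h2.snd
  by_cases hk : k ∈ Finset.range s
  · simp only [Function.updateFinset, hk, dif_pos]
    exact (measurable_pi_apply (⟨k, hk⟩ : Finset.range s)).comp measurable_fst
  · simp only [Function.updateFinset, hk, dif_neg, not_false_iff]
    exact h2.fst

lemma spl_update {s N : ℕ} (hN : s ≤ N) (a : Finset.range s → 𝓧) (z : ℕ → 𝓧 × 𝓨)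
    (z' : 𝓧 × 𝓨) : spl s a (Function.update z N z') = Function.update (spl s a z) N z' := by
  funext k
  by_cases hk : k = N
  · subst hk; simp [spl_ge hN]
  · rw [Function.update_of_ne hk]
    by_cases hks : k < s
    · simp [spl, Function.updateFinset, hks, Function.update_of_ne hk]
    · rw [spl_ge (not_lt.1 hks), spl_ge (not_lt.1 hks), Function.update_of_ne hk]

/-- expectation with spliced first observations -/
noncomputable def Dop (P : Measure Ω) (Z : ℕ → Ω → 𝓧 × 𝓨) (μ : Measure 𝓧) (s : ℕ)
    (F : (ℕ → 𝓧 × 𝓨) → ℝ≥0∞) : ℝ≥0∞ :=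
  ∫⁻ a, ∫⁻ ω, F (spl s a (pth Z ω)) ∂P ∂(Measure.pi fun _ : Finset.range s => μ)

/-- dependence on `x_{0:N}` and `y_{t:N}` only -/
def Dep (t N : ℕ) (F : (ℕ → 𝓧 × 𝓨) → ℝ≥0∞) : Prop :=
  ∀ z z' : ℕ → 𝓧 × 𝓨, (∀ i, i ≤ N → (z i).1 = (z' i).1) →
    (∀ i, t ≤ i → i ≤ N → z i = z' i) → F z = F z'

lemma Dep.dependsOn {t N : ℕ} {F : (ℕ → 𝓧 × 𝓨) → ℝ≥0∞} (h : Dep t N F) :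
    DependsOn F (Set.Iic N) := by
  intro z z' hz
  exact h z z' (fun i hi => by rw [hz i hi]) fun i _ hi => hz i hi

/-- comparison set -/
def Bset (μ : Measure 𝓧) (p0 : 𝓧 × 𝓨 → ℝ≥0∞) (q : 𝓧 × 𝓨 → 𝓧 × 𝓨 → ℝ≥0∞) (s t : ℕ)
    (lo hi : ℝ≥0∞) : Set (ℕ → 𝓧) :=
  {x | ∀ i, lo * alp' μ p0 q s t x i ≤ alp p0 q t x i ∧
    alp p0 q t x i ≤ hi * alp' μ p0 q s t x i}

lemma Bset_congr {μ : Measure 𝓧} {p0 : 𝓧 × 𝓨 → ℝ≥0∞} {q : 𝓧 × 𝓨 → 𝓧 × 𝓨 → ℝ≥0∞} {s t : ℕ}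
    {lo hi : ℝ≥0∞} {x y : ℕ → 𝓧} (h : ∀ i ≤ t, x i = y i) (hx : x ∈ Bset μ p0 q s t lo hi) :
    y ∈ Bset μ p0 q s t lo hi := by
  intro i
  rw [← show alp' μ p0 q s t x i = alp' μ p0 q s t y i from
      alp'_dep μ p0 q s t i fun i hi => h i hi.2,
      ← show alp p0 q t x i = alp p0 q t y i from alp_dep p0 q t i h]
  exact hx i

lemma measurableSet_Bset {μ : Measure 𝓧} [SigmaFinite μ] {q : 𝓧 × 𝓨 → 𝓧 × 𝓨 → ℝ≥0∞}
    (hq : Measurable (Function.uncurry q))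
    {p0 : 𝓧 × 𝓨 → ℝ≥0∞} (hp : Measurable p0) (s t : ℕ) (lo hi : ℝ≥0∞) :
    MeasurableSet (Bset μ p0 q s t lo hi) := by
  have : Bset μ p0 q s t lo hi = ⋂ i, ({x | lo * alp' μ p0 q s t x i ≤ alp p0 q t x i} ∩
    {x | alp p0 q t x i ≤ hi * alp' μ p0 q s t x i}) := by
    ext x; simp [Bset]
  rw [this]
  exact MeasurableSet.iInter fun i => (measurableSet_le
    ((measurable_alp' hq hp s t i).const_mul _) (measurable_alp hq hp t i)).inter
    (measurableSet_le (measurable_alp hq hp t i) ((measurable_alp' hq hp s t i).const_mul _))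

lemma Dop_base {P : Measure Ω} {Z : ℕ → Ω → 𝓧 × 𝓨}
    {κ : Kernel (𝓧 × 𝓨) (𝓧 × 𝓨)} [IsMarkovKernel κ]
    {μ : Measure 𝓧} {q : 𝓧 × 𝓨 → 𝓧 × 𝓨 → ℝ≥0∞} {p0 : 𝓧 × 𝓨 → ℝ≥0∞}
    (hP : IsPMM P Z κ μ q p0) {s t : ℕ} (hst : s ≤ t)
    (f : (ℕ → 𝓧) → 𝓨 → ℝ≥0∞) (hf : ∀ j, Measurable (fun x => f x j))
    (hd : ∀ j, DependsOn (fun x => f x j) (Set.Iic t)) (x0 : ℕ → 𝓧) :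
    Dop P Z μ s (fun z => f (fun k => (z k).1) (z t).2) =
      ∑ j, lmarginal (fun _ => μ) (Finset.range (t + 1))
        (fun x => f x j * alp' μ p0 q s t x j) x0 := by
  have hP' := hP
  obtain ⟨h1, h2, h3, h4, h5, h6, h7⟩ := hP
  have hma : ∀ j, Measurable (fun x => f x j * alp' μ p0 q s t x j) := fun j =>
    (hf j).mul (measurable_alp' h4 h5 s t j)
  have e1 : ∀ a, ∫⁻ ω, f (fun k => (spl s a (pth Z ω) k).1) (spl s a (pth Z ω) t).2 ∂P =
      ∑ j, lmarginal (fun _ => μ) (Finset.Icc s t)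
        (fun x => f x j * alp' μ p0 q s t x j)
        (Function.updateFinset x0 (Finset.range s) a) := by
    intro a
    have hfa : ∀ j, Measurable (fun x => f (Function.updateFinset x (Finset.range s) a) j) :=
      fun j => (hf j).comp (measurable_updateFinset'.comp (measurable_id.prodMk measurable_const))
    have hfd : ∀ j, DependsOn (fun x => f (Function.updateFinset x (Finset.range s) a) j)
        (Set.Icc s t) := by
      intro j x y hxy
      refine hd j fun i hi => ?_
      by_cases his : i < s
      · simp [Function.updateFinset, his]
      · simp [Function.updateFinset, his, hxy i ⟨not_lt.1 his, hi⟩]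
    have := dens hP' t (fun x j => f (Function.updateFinset x (Finset.range s) a) j) hfa
      (fun j a b hab => hfd j fun i hi => hab i hi.2) x0
    refine Eq.trans this ?_
    refine Finset.sum_congr rfl fun j _ => ?_
    rw [lmarg_alp' h4 h5 hst (hfa j)
      (fun a b hab => hfd j fun i hi => hab i (by have := hi.1; simp; omega))]
    simp only [lmarginal]
    refine lintegral_congr fun u => ?_
    have hx : Function.updateFinset (Function.updateFinset x0 (Finset.Icc s t) u)
        (Finset.range s) a = Function.updateFinset (Function.updateFinset x0 (Finset.range s) a)
          (Finset.Icc s t) u := by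
      funext k
      by_cases hk : k < s
      · have : ¬ (s ≤ k) := not_le.2 hk
        simp [Function.updateFinset, hk, this]
      · by_cases hk2 : s ≤ k ∧ k ≤ t <;> simp [Function.updateFinset, hk, hk2]
    rw [hx]
    congr 1
    refine alp'_dep μ p0 q s t j fun k hk => ?_
    have hk' : s ≤ k ∧ k ≤ t := hk
    simp [Function.updateFinset, hk']
  simp only [Dop]
  simp_rw [e1]
  rw [lintegral_finsetSum (f := fun j a => lmarginal (fun _ => μ) (Finset.Icc s t)
        (fun x => f x j * alp' μ p0 q s t x j) (Function.updateFinset x0 (Finset.range s) a)) _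
    fun j _ => ((hma j).lmarginal _).comp measurable_updateFinset]
  refine Finset.sum_congr rfl fun j _ => ?_
  rw [range_split hst, lmarginal_union _ _ (hma j) (range_disj s t)]
  rfl

lemma measurable_pth {S : Type*} [MeasurableSpace S] {Z : ℕ → Ω → S}
    (hZ : ∀ k, Measurable (Z k)) : Measurable (pth Z) :=
  measurable_pi_lambda _ hZ

lemma Dop_Kop {P : Measure Ω} [IsFiniteMeasure P] {Z : ℕ → Ω → 𝓧 × 𝓨}
    {κ : Kernel (𝓧 × 𝓨) (𝓧 × 𝓨)} [IsMarkovKernel κ] (h : IsMarkovChain P Z κ)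
    {μ : Measure 𝓧} {s N : ℕ} (hN : s ≤ N) {F : (ℕ → 𝓧 × 𝓨) → ℝ≥0∞} (hF : Measurable F)
    (hd : DependsOn F (Set.Iic (N + 1))) :
    Dop P Z μ s F = Dop P Z μ s (Kop κ N F) := by
  simp only [Dop]
  refine lintegral_congr fun a => ?_
  have hm : Measurable (fun z => F (spl s a z)) :=
    hF.comp ((measurable_spl s).comp (measurable_const.prodMk measurable_id))
  have := markov_Kop h N (C := Set.univ) MeasurableSet.univ hm (by
    intro z z' hz
    refine hd fun i hi => ?_
    by_cases his : i < s
    · simp [spl, Function.updateFinset, his, hz i hi]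
    · rw [spl_ge (not_lt.1 his), spl_ge (not_lt.1 his), hz i hi])
  simp only [Measure.restrict_univ] at this
  rw [this]
  refine lintegral_congr fun ω => ?_
  simp only [Kop]
  rw [spl_ge hN]
  refine lintegral_congr fun z' => ?_
  rw [spl_update (by omega)]

lemma compare {P : Measure Ω} {Z : ℕ → Ω → 𝓧 × 𝓨}
    {κ : Kernel (𝓧 × 𝓨) (𝓧 × 𝓨)} [IsMarkovKernel κ]
    {μ : Measure 𝓧} {q : 𝓧 × 𝓨 → 𝓧 × 𝓨 → ℝ≥0∞} {p0 : 𝓧 × 𝓨 → ℝ≥0∞}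
    (hP : IsPMM P Z κ μ q p0) {s t : ℕ} (hst : s ≤ t) (lo hi : ℝ≥0∞) (k : ℕ) :
    ∀ F : (ℕ → 𝓧 × 𝓨) → ℝ≥0∞, Measurable F → Dep t (t + k) F →
    (∀ z, F z ≠ 0 → (fun k => (z k).1) ∈ Bset μ p0 q s t lo hi) →
    lo * Dop P Z μ s F ≤ ∫⁻ ω, F (pth Z ω) ∂P ∧
      ∫⁻ ω, F (pth Z ω) ∂P ≤ hi * Dop P Z μ s F := by
  have hP' := hP
  obtain ⟨h1, h2, h3, h4, h5, h6, h7⟩ := hP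
  obtain ⟨ω0⟩ : Nonempty Ω := nonempty_of_isProbabilityMeasure P
  induction k with
  | zero =>
    intro F hF hd hv
    let f : (ℕ → 𝓧) → 𝓨 → ℝ≥0∞ := fun x j => F (fun k => (x k, j))
    have hf : ∀ j, Measurable (fun x => f x j) := fun j =>
      hF.comp (measurable_pi_lambda _ fun k => (measurable_pi_apply k).prodMk measurable_const)
    have hfd : ∀ j, DependsOn (fun x => f x j) (Set.Iic t) := by
      intro j x y hxy
      refine hd _ _ (fun i hi => hxy i hi) fun i _ hi => ?_
      rw [hxy i hi]
    have hFf : ∀ z, F z = f (fun k => (z k).1) (z t).2 := by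
      intro z
      refine hd _ _ (fun i _ => rfl) fun i h1 h2 => ?_
      have : i = t := by omega
      subst this
      rfl
    have hFf' : F = fun z => f (fun k => (z k).1) (z t).2 := funext hFf
    have hD := Dop_base hP' hst f hf hfd (xp Z ω0)
    rw [← hFf'] at hD
    have hE := dens hP' t f hf hfd (xp Z ω0)
    have hE' : ∫⁻ ω, F (pth Z ω) ∂P = ∫⁻ ω, f (xp Z ω) (Z t ω).2 ∂P :=
      lintegral_congr fun ω => hFf _
    have hma : ∀ j, Measurable (fun x => f x j * alp' μ p0 q s t x j) := fun j =>
      (hf j).mul (measurable_alp' h4 h5 s t j)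
    have hc : ∀ c : ℝ≥0∞, c * Dop P Z μ s F = ∑ j, lmarginal (fun _ => μ) (Finset.range (t + 1))
        (fun x => c * (f x j * alp' μ p0 q s t x j)) (xp Z ω0) := by
      intro c
      rw [hD, Finset.mul_sum]
      refine Finset.sum_congr rfl fun j _ => ?_
      rw [lmarg_mul (g := fun _ => c) μ _ (hma j) (fun _ _ _ => rfl)]
    have key : ∀ x j, lo * (f x j * alp' μ p0 q s t x j) ≤ f x j * alp p0 q t x j ∧
        f x j * alp p0 q t x j ≤ hi * (f x j * alp' μ p0 q s t x j) := by
      intro x j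
      by_cases hx : f x j = 0
      · simp [hx]
      · have := hv (fun k => (x k, j)) hx j
        constructor
        · calc lo * (f x j * alp' μ p0 q s t x j) = f x j * (lo * alp' μ p0 q s t x j) := by ring
            _ ≤ _ := by gcongr; exact this.1
        · calc f x j * alp p0 q t x j ≤ f x j * (hi * alp' μ p0 q s t x j) := by
                gcongr; exact this.2
            _ = _ := by ring
    rw [hc, hc, hE', hE]
    exact ⟨Finset.sum_le_sum fun j _ => lmarginal_mono (fun x => (key x j).1) _,
      Finset.sum_le_sum fun j _ => lmarginal_mono (fun x => (key x j).2) _⟩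
  | succ k ih =>
    intro F hF hd hv
    have hdd := hd.dependsOn
    have hK := markov_Kop h2 (t + k) (C := Set.univ) MeasurableSet.univ hF hdd
    simp only [Measure.restrict_univ] at hK
    rw [Dop_Kop h2 (N := t + k) (by omega) hF hdd, hK]
    refine ih _ (measurable_Kop κ _ hF) ?_ ?_
    · intro z z' hz1 hz2
      simp only [Kop]
      rw [hz2 (t + k) (by omega) le_rfl]
      refine lintegral_congr fun w => hd _ _ ?_ ?_
      · intro i hi
        by_cases hi' : i = t + k + 1
        · subst hi'; simp
        · rw [Function.update_of_ne hi', Function.update_of_ne hi']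
          exact hz1 i (by omega)
      · intro i hti hi
        by_cases hi' : i = t + k + 1
        · subst hi'; simp
        · rw [Function.update_of_ne hi', Function.update_of_ne hi']
          exact hz2 i hti (by omega)
    · intro z hz
      by_contra hB
      apply hz
      simp only [Kop]
      have : ∀ w, F (Function.update z (t + k + 1) w) = 0 := by
        intro w
        by_contra hw
        refine hB (Bset_congr ?_ (hv _ hw))
        intro i hi
        rw [Function.update_of_ne (by omega)]
      simp [this]

end Splice

section SmoothCompare

open Classical in
/-- truncation of a path -/
noncomputable def trc (s n : ℕ) (x0 x : ℕ → 𝓧) (k : ℕ) : 𝓧 := if k ∈ Set.Icc s n then x k else x0 k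

lemma measurable_trc_xp (Z : ℕ → Ω → 𝓧 × 𝓨) (s n : ℕ) (x0 : ℕ → 𝓧) :
    Measurable[obsSigma Z s n] (fun ω => trc s n x0 (xp Z ω)) := by
  refine @measurable_pi_lambda _ _ _ (_) _ _ (fun k => ?_)
  by_cases hk : k ∈ Set.Icc s n
  · simp only [trc, hk, if_true]
    have h1 : MeasurableSpace.comap (fun ω => (Z k ω).1) inferInstance ≤ obsSigma Z s n :=
      le_iSup₂ (f := fun i (_ : i ∈ Set.Icc s n) =>
        MeasurableSpace.comap (fun ω => (Z i ω).1) inferInstance) k hk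
    exact (comap_measurable (fun ω => (Z k ω).1)).mono h1 le_rfl
  · simp only [trc, hk, if_false]
    exact @measurable_const _ _ _ (_) _

lemma obs_meas (Z : ℕ → Ω → 𝓧 × 𝓨) (s n : ℕ) (x0 : ℕ → 𝓧) {C : Set (ℕ → 𝓧)}
    (hC : MeasurableSet C)
    (hd : ∀ x y, (∀ i ∈ Set.Icc s n, x i = y i) → x ∈ C → y ∈ C) :
    MeasurableSet[obsSigma Z s n] {ω | xp Z ω ∈ C} := by
  have : {ω | xp Z ω ∈ C} = (fun ω => trc s n x0 (xp Z ω)) ⁻¹' C := by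
    ext ω
    constructor
    · exact hd _ _ fun i hi => by simp only [trc, hi, if_true]
    · exact hd _ _ fun i hi => by simp only [trc, hi, if_true]
  rw [this]
  exact measurable_trc_xp Z s n x0 hC

lemma obs_factor (Z : ℕ → Ω → 𝓧 × 𝓨) (s n : ℕ) (x0 : ℕ → 𝓧) {g : Ω → ℝ}
    (hg : StronglyMeasurable[obsSigma Z s n] g) :
    ∃ h : (ℕ → 𝓧) → ℝ, Measurable h ∧ DependsOn h (Set.Icc s n) ∧ ∀ ω, g ω = h (xp Z ω) := by
  have hle : obsSigma Z s n ≤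
      MeasurableSpace.comap (fun ω => trc s n x0 (xp Z ω)) inferInstance := by
    refine iSup₂_le fun i hi => ?_
    have : (fun ω => (Z i ω).1) = (fun x : ℕ → 𝓧 => x i) ∘ (fun ω => trc s n x0 (xp Z ω)) := by
      funext ω
      simp only [Function.comp, trc, hi, if_true, xp]
    rw [this, ← MeasurableSpace.comap_comp]
    exact MeasurableSpace.comap_mono (measurable_pi_apply i).comap_le
  obtain ⟨h, hh, he⟩ := (hg.mono hle).exists_eq_measurable_comp
  refine ⟨fun x => h (trc s n x0 x), ?_, ?_, ?_⟩
  · refine hh.measurable.comp (measurable_pi_lambda _ fun k => ?_)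
    by_cases hk : k ∈ Set.Icc s n
    · simp only [trc, hk, if_true]
      exact measurable_pi_apply k
    · simp only [trc, hk, if_false]
      exact measurable_const
  · intro x y hxy
    simp only
    congr 1
    funext k
    by_cases hk : k ∈ Set.Icc s n
    · simp only [trc, hk, if_true, hxy k hk]
    · simp only [trc, hk, if_false]
  · intro ω
    rw [he]
    rfl

lemma obs_le {Z : ℕ → Ω → 𝓧 × 𝓨} (hZ : ∀ k, Measurable (Z k)) (s n : ℕ) :
    obsSigma Z s n ≤ ‹MeasurableSpace Ω› :=
  iSup₂_le fun i _ => (hZ i).fst.comap_le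

/-- the event -/
def Aev (Z : ℕ → Ω → 𝓧 × 𝓨) (t : ℕ) {m : ℕ} (v : Fin m → 𝓨) : Set Ω :=
  {ω | ∀ i : Fin m, (Z (t + (i : ℕ)) ω).2 = v i}

lemma measurableSet_Aev {Z : ℕ → Ω → 𝓧 × 𝓨} (hZ : ∀ k, Measurable (Z k)) (t : ℕ) {m : ℕ}
    (v : Fin m → 𝓨) : MeasurableSet (Aev Z t v) := by
  have : Aev Z t v = ⋂ i : Fin m, (fun ω => (Z (t + (i : ℕ)) ω).2) ⁻¹' {v i} := by
    ext ω; simp [Aev]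
  rw [this]
  exact MeasurableSet.iInter fun i => (hZ _).snd (measurableSet_singleton _)

lemma integrable_Aev {P : Measure Ω} [IsProbabilityMeasure P] {Z : ℕ → Ω → 𝓧 × 𝓨}
    (hZ : ∀ k, Measurable (Z k)) (t : ℕ) {m : ℕ} (v : Fin m → 𝓨) :
    Integrable ((Aev Z t v).indicator (fun _ => (1 : ℝ))) P :=
  (integrable_const (1 : ℝ)).indicator (measurableSet_Aev hZ t v)

lemma smooth_nonneg {P : Measure Ω} (Z : ℕ → Ω → 𝓧 × 𝓨)
    (t l n : ℕ) {m : ℕ} (v : Fin m → 𝓨) : ∀ᵐ ω ∂P, 0 ≤ smooth P Z t l n v ω :=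
  condExp_nonneg (ae_of_all _ fun ω => Set.indicator_nonneg (fun _ _ => zero_le_one) ω)

lemma smooth_lintegral {P : Measure Ω} [IsProbabilityMeasure P] {Z : ℕ → Ω → 𝓧 × 𝓨}
    (hZ : ∀ k, Measurable (Z k)) (t l n : ℕ) {m : ℕ} (v : Fin m → 𝓨) {C : Set Ω}
    (hC : MeasurableSet[obsSigma Z l n] C) :
    ∫⁻ ω in C, (Aev Z t v).indicator (fun _ => 1) ω ∂P =
      ∫⁻ ω in C, ENNReal.ofReal (smooth P Z t l n v ω) ∂P := by
  have h1 := setIntegral_condExp (obs_le hZ l n) (integrable_Aev (P := P) hZ t v) hC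
  rw [← ofReal_integral_eq_lintegral_ofReal]
  · rw [show ∫ ω in C, smooth P Z t l n v ω ∂P = _ from h1, ofReal_integral_eq_lintegral_ofReal]
    · refine lintegral_congr fun ω => ?_
      by_cases h : ω ∈ Aev Z t v <;> simp [h]
    · exact (integrable_Aev hZ t v).integrableOn
    · exact ae_of_all _ fun ω => Set.indicator_nonneg (fun _ _ => zero_le_one) ω
  · exact integrable_condExp.integrableOn
  · exact ae_restrict_of_ae (smooth_nonneg Z t l n v)

lemma smooth_compare {P : Measure Ω} {Z : ℕ → Ω → 𝓧 × 𝓨}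
    {κ : Kernel (𝓧 × 𝓨) (𝓧 × 𝓨)} [IsMarkovKernel κ]
    {μ : Measure 𝓧} {q : 𝓧 × 𝓨 → 𝓧 × 𝓨 → ℝ≥0∞} {p0 : 𝓧 × 𝓨 → ℝ≥0∞}
    (hP : IsPMM P Z κ μ q p0) {s t n : ℕ} (hst : s ≤ t) (htn : t ≤ n) {m : ℕ} (v : Fin m → 𝓨)
    {lo hi : ℝ} (hlo : 0 ≤ lo) (hhi : 0 ≤ hi) :
    ∀ᵐ ω ∂P, xp Z ω ∈ Bset μ p0 q s t (ENNReal.ofReal lo) (ENNReal.ofReal hi) →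
      lo * smooth P Z t s n v ω ≤ hi * smooth P Z t 0 n v ω := by
  have hP' := hP
  obtain ⟨h1, h2, h3, h4, h5, h6, h7⟩ := hP
  have hZ := h2.1
  obtain ⟨ω0⟩ : Nonempty Ω := nonempty_of_isProbabilityMeasure P
  let x0 := xp Z ω0
  obtain ⟨f0, hf0, hf0d, hf0e⟩ := obs_factor Z 0 n x0
    (g := smooth P Z t 0 n v) stronglyMeasurable_condExp
  obtain ⟨fs, hfs, hfsd, hfse⟩ := obs_factor Z s n x0
    (g := smooth P Z t s n v) stronglyMeasurable_condExp
  let G : Set (ℕ → 𝓧) := {x | x ∈ Bset μ p0 q s t (ENNReal.ofReal lo) (ENNReal.ofReal hi) ∧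
    hi * f0 x < lo * fs x}
  have hG : MeasurableSet G := (measurableSet_Bset h4 h5 s t _ _).inter
    (measurableSet_lt (hf0.const_mul _) (hfs.const_mul _))
  have hGd : ∀ x y, (∀ i ≤ n, x i = y i) → x ∈ G → y ∈ G := by
    intro x y hxy hx
    refine ⟨Bset_congr (fun i hi => hxy i (hi.trans htn)) hx.1, ?_⟩
    rw [← hf0d (x := x) (y := y) fun i hi => hxy i hi.2,
      ← hfsd (x := x) (y := y) fun i hi => hxy i hi.2]
    exact hx.2
  have hGd2 : ∀ x y, (∀ i ≤ n, x i = y i) → (x ∈ G ↔ y ∈ G) := fun x y hxy =>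
    ⟨hGd x y hxy, hGd y x fun i hi => (hxy i hi).symm⟩
  let W : Set Ω := {ω | xp Z ω ∈ G}
  have hW : MeasurableSet[obsSigma Z 0 n] W :=
    obs_meas Z 0 n x0 hG fun x y hxy => hGd x y fun i hi => hxy i ⟨Nat.zero_le _, hi⟩
  have hW' : MeasurableSet W := obs_le hZ 0 n _ hW
  let pr : (ℕ → 𝓧 × 𝓨) → (ℕ → 𝓧) := fun z k => (z k).1
  have hpr : Measurable pr := measurable_pi_lambda _ fun k => (measurable_pi_apply k).fst
  let A' : Set (ℕ → 𝓧 × 𝓨) := Aev (fun k (z : ℕ → 𝓧 × 𝓨) => z k) t v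
  have hA' : MeasurableSet A' := measurableSet_Aev (fun k => measurable_pi_apply k) t v
  let F1 : (ℕ → 𝓧 × 𝓨) → ℝ≥0∞ := fun z =>
    (pr ⁻¹' G).indicator (fun z => A'.indicator (fun _ => 1) z) z
  let F2 : (ℕ → 𝓧 × 𝓨) → ℝ≥0∞ := fun z =>
    (pr ⁻¹' G).indicator (fun z => ENNReal.ofReal (fs (pr z))) z
  have hF1 : Measurable F1 := (measurable_const.indicator hA').indicator (hpr hG)
  have hF2 : Measurable F2 := ((hfs.comp hpr).ennreal_ofReal).indicator (hpr hG)
  have hd1 : Dep t (t + (n + m)) F1 := by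
    intro z z' hz1 hz2
    have e1 : z ∈ pr ⁻¹' G ↔ z' ∈ pr ⁻¹' G := hGd2 _ _ fun i hi => hz1 i (by omega)
    have e2 : z ∈ A' ↔ z' ∈ A' := by
      refine forall_congr' fun i => ?_
      have := i.2
      change (z (t + (i : ℕ))).2 = v i ↔ (z' (t + (i : ℕ))).2 = v i
      rw [hz2 (t + i) (by omega) (by omega)]
    classical
    simp only [F1, Set.indicator_apply, e1, e2]
  have hd2 : Dep t (t + (n + m)) F2 := by
    intro z z' hz1 hz2
    have e1 : z ∈ pr ⁻¹' G ↔ z' ∈ pr ⁻¹' G := hGd2 _ _ fun i hi => hz1 i (by omega)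
    have e2 : fs (pr z) = fs (pr z') := hfsd fun i hi => hz1 i (by have := hi.2; omega)
    classical
    simp only [F2, Set.indicator_apply, e1, e2]
  have hc1 := (compare hP' hst (ENNReal.ofReal lo) (ENNReal.ofReal hi) (n + m) F1 hF1 hd1 (by
    intro z hz
    exact (Set.mem_of_indicator_ne_zero hz).1)).1
  have hc2 := (compare hP' hst (ENNReal.ofReal lo) (ENNReal.ofReal hi) (n + m) F2 hF2 hd2 (by
    intro z hz
    exact (Set.mem_of_indicator_ne_zero hz).1)).2
  have hD : Dop P Z μ s F1 = Dop P Z μ s F2 := by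
    simp only [Dop]
    refine lintegral_congr fun a => ?_
    let C : Set (ℕ → 𝓧) := {x | Function.updateFinset x (Finset.range s) a ∈ G}
    have hC : MeasurableSet C :=
      (measurable_updateFinset'.comp (measurable_id.prodMk measurable_const)) hG
    have hCo : MeasurableSet[obsSigma Z s n] {ω | xp Z ω ∈ C} := by
      refine obs_meas Z s n x0 hC fun x y hxy hx => ?_
      refine hGd _ _ (fun i hi => ?_) hx
      by_cases his : i < s
      · simp [Function.updateFinset, his]
      · simp [Function.updateFinset, his, hxy i ⟨not_lt.1 his, hi⟩]
    have := smooth_lintegral (P := P) hZ t s n v hCo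
    rw [← lintegral_indicator (obs_le hZ s n _ hCo), ← lintegral_indicator (obs_le hZ s n _ hCo)]
      at this
    have e1 : ∀ ω, F1 (spl s a (pth Z ω)) =
        {ω | xp Z ω ∈ C}.indicator ((Aev Z t v).indicator (fun _ => 1)) ω := by
      intro ω
      have a1 : spl s a (pth Z ω) ∈ pr ⁻¹' G ↔ ω ∈ {ω | xp Z ω ∈ C} := Iff.rfl
      have a2 : spl s a (pth Z ω) ∈ A' ↔ ω ∈ Aev Z t v := Iff.rfl
      classical
      simp only [F1, Set.indicator_apply, a1, a2]
    have e2 : ∀ ω, F2 (spl s a (pth Z ω)) =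
        {ω | xp Z ω ∈ C}.indicator (fun ω => ENNReal.ofReal (smooth P Z t s n v ω)) ω := by
      intro ω
      have a1 : spl s a (pth Z ω) ∈ pr ⁻¹' G ↔ ω ∈ {ω | xp Z ω ∈ C} := Iff.rfl
      have a2 : fs (pr (spl s a (pth Z ω))) = smooth P Z t s n v ω := by
        rw [hfse]
        refine hfsd fun i hi => ?_
        simp only [pr]
        rw [spl_ge hi.1]
        rfl
      classical
      simp only [F2, Set.indicator_apply, a1, a2]
    simp_rw [e1, e2]
    exact this
  have hE1 : ∫⁻ ω, F1 (pth Z ω) ∂P = ∫⁻ ω in W, ENNReal.ofReal (smooth P Z t 0 n v ω) ∂P := by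
    rw [← smooth_lintegral hZ t 0 n v hW, ← lintegral_indicator hW']
    rfl
  have hE2 : ∫⁻ ω, F2 (pth Z ω) ∂P = ∫⁻ ω in W, ENNReal.ofReal (smooth P Z t s n v ω) ∂P := by
    rw [← lintegral_indicator hW']
    refine lintegral_congr fun ω => ?_
    have a1 : pth Z ω ∈ pr ⁻¹' G ↔ ω ∈ W := Iff.rfl
    have a2 : fs (pr (pth Z ω)) = smooth P Z t s n v ω := (hfse ω).symm
    classical
    simp only [F2, Set.indicator_apply, a1, a2]
  rw [hE1, hD] at hc1
  rw [hE2] at hc2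
  have hm0 : Measurable (smooth P Z t 0 n v) :=
    (stronglyMeasurable_condExp.mono (obs_le hZ 0 n)).measurable
  have hms : Measurable (smooth P Z t s n v) :=
    (stronglyMeasurable_condExp.mono (obs_le hZ s n)).measurable
  have hfin : ∫⁻ ω in W, ENNReal.ofReal (smooth P Z t 0 n v ω) ∂P ≠ ⊤ := by
    rw [← smooth_lintegral hZ t 0 n v hW]
    refine ne_top_of_le_ne_top (b := ∫⁻ ω in W, 1 ∂P) (by simp) (lintegral_mono fun ω => ?_)
    exact Set.indicator_le_self' (fun _ _ => zero_le) ω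
  have hfinal : ∫⁻ ω in W, ENNReal.ofReal (lo * smooth P Z t s n v ω) ∂P ≤
      ∫⁻ ω in W, ENNReal.ofReal (hi * smooth P Z t 0 n v ω) ∂P := by
    simp_rw [ENNReal.ofReal_mul hlo, ENNReal.ofReal_mul hhi]
    rw [lintegral_const_mul _ hms.ennreal_ofReal, lintegral_const_mul _ hm0.ennreal_ofReal]
    calc _ ≤ ENNReal.ofReal lo * (ENNReal.ofReal hi * Dop P Z μ s F2) := by gcongr
      _ = ENNReal.ofReal hi * (ENNReal.ofReal lo * Dop P Z μ s F2) := by ring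
      _ ≤ _ := by gcongr
  have hPW : P W = 0 := by
    by_contra hne
    refine absurd hfinal (not_le.2 ?_)
    refine setLIntegral_strict_mono hW' hne ((hms.const_mul _).ennreal_ofReal) ?_ ?_
    · simp_rw [ENNReal.ofReal_mul hhi]
      rw [lintegral_const_mul _ hm0.ennreal_ofReal]
      exact ENNReal.mul_ne_top ENNReal.ofReal_ne_top hfin
    · filter_upwards [smooth_nonneg (P := P) Z t 0 n v] with ω hω hωW
      have hlt : hi * f0 (xp Z ω) < lo * fs (xp Z ω) := hωW.2
      rw [← hf0e, ← hfse] at hlt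
      exact (ENNReal.ofReal_lt_ofReal_iff ((mul_nonneg hhi hω).trans_lt hlt)).2 hlt
  have : ∀ᵐ ω ∂P, ω ∉ W := measure_eq_zero_iff_ae_notMem.1 hPW
  filter_upwards [this] with ω hω hB
  by_contra hcon
  apply hω
  refine ⟨hB, ?_⟩
  rw [← hf0e, ← hfse]
  exact not_le.1 hcon

end SmoothCompare

section Contraction

lemma bet_pijD (q : 𝓧 × 𝓨 → 𝓧 × 𝓨 → ℝ≥0∞) (N R : ℕ) (i : 𝓨) (x : ℕ → 𝓧) (j : 𝓨) :
    bet q N R i x j = pijD q (fun k : Fin (R + 1) => x (N + (k : ℕ))) i j := by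
  induction R generalizing j with
  | zero =>
    simp only [bet, pijD]
    rw [← (Equiv.funUnique (Fin 1) 𝓨).symm.sum_comp]
    by_cases hij : i = j
    · subst hij
      simp [Finset.sum_ite_eq']
    · have : ∀ y : 𝓨, ¬ (y = i ∧ y = j) := fun y h => hij (h.1.symm.trans h.2)
      simp [hij, this]
  | succ R ih =>
    simp only [bet, ih]
    simp only [pijD]
    rw [← (Fin.snocEquiv (fun _ : Fin (R + 2) => 𝓨)).sum_comp, Fintype.sum_prod_type]
    have e : ∀ (b : 𝓨) (y : Fin (R + 1) → 𝓨),
        (if (Fin.snocEquiv (fun _ : Fin (R + 2) => 𝓨)) (b, y) 0 = i ∧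
          (Fin.snocEquiv (fun _ : Fin (R + 2) => 𝓨)) (b, y) (Fin.last (R + 1)) = j then
        ∏ k : Fin (R + 1), q (x (N + (k.succ : Fin (R + 2))),
            (Fin.snocEquiv (fun _ : Fin (R + 2) => 𝓨)) (b, y) k.succ)
          (x (N + (k.castSucc : Fin (R + 2))),
            (Fin.snocEquiv (fun _ : Fin (R + 2) => 𝓨)) (b, y) k.castSucc) else 0) =
        if b = j then (if y 0 = i then
          (∏ k : Fin R, q (x (N + (k.succ : Fin (R + 1))), y k.succ)
            (x (N + (k.castSucc : Fin (R + 1))), y k.castSucc)) *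
            q (x (N + R + 1), j) (x (N + R), y (Fin.last R)) else 0) else 0 := by
      intro b y
      have h0 : (Fin.snocEquiv (fun _ : Fin (R + 2) => 𝓨)) (b, y) 0 = y 0 := by
        change (Fin.snoc (α := fun _ => 𝓨) y b : Fin (R + 2) → 𝓨) (Fin.castSucc 0) = y 0
        rw [Fin.snoc_castSucc]
      have h1 : (Fin.snocEquiv (fun _ : Fin (R + 2) => 𝓨)) (b, y) (Fin.last (R + 1)) = b := by
        change (Fin.snoc (α := fun _ => 𝓨) y b : Fin (R + 2) → 𝓨) (Fin.last (R + 1)) = b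
        rw [Fin.snoc_last]
      have h2 : ∀ k : Fin (R + 1),
          (Fin.snocEquiv (fun _ : Fin (R + 2) => 𝓨)) (b, y) k.castSucc = y k := by
        intro k
        change (Fin.snoc (α := fun _ => 𝓨) y b : Fin (R + 2) → 𝓨) k.castSucc = y k
        rw [Fin.snoc_castSucc]
      rw [Fin.prod_univ_castSucc, h0, h1]
      by_cases hb : b = j
      · subst hb
        by_cases hy : y 0 = i
        · simp only [hy, and_self, if_true]
          rw [Fin.succ_last, h1, h2]
          congr 1
          refine Finset.prod_congr rfl fun k _ => ?_
          rw [Fin.succ_castSucc, h2, h2]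
          rfl
        · simp [hy]
      · simp [hb]
    refine Eq.trans ?_ (Finset.sum_congr rfl fun b _ => Finset.sum_congr rfl fun y _ =>
      (e b y).symm)
    rw [Finset.sum_comm]
    simp only [Finset.sum_ite_eq', Finset.mem_univ, if_true, Finset.sum_mul]
    rw [Finset.sum_comm]
    refine Finset.sum_congr rfl fun y _ => ?_
    rw [Finset.sum_eq_single (y (Fin.last R))]
    · by_cases hy : y 0 = i <;> simp [hy]
    · intro b _ hb
      simp [hb.symm]
    · simp

lemma contr_real (S1 S2 : Finset 𝓨) (a b : 𝓨 → ℝ) (w : 𝓨 → 𝓨 → ℝ) (lo hi M : ℝ)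
    (hb : ∀ i, 0 ≤ b i) (hlo : 0 ≤ lo) (hM : 1 ≤ M)
    (h1 : ∀ i, lo * b i ≤ a i) (h2 : ∀ i, a i ≤ hi * b i)
    (hw0 : ∀ i j, ¬ (i ∈ S1 ∧ j ∈ S2) → w i j = 0)
    (hw1 : ∀ i j, i ∈ S1 → j ∈ S2 → 1 / M ≤ w i j ∧ w i j ≤ M)
    (hσ : 0 < ∑ i ∈ S1, a i) :
    ∃ lo' hi' : ℝ, 0 < lo' ∧ lo ≤ lo' ∧ lo' ≤ hi' ∧ hi' - lo' = (1 - 1 / M ^ 2) * (hi - lo) ∧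
      ∀ j, lo' * (∑ i, b i * w i j) ≤ ∑ i, a i * w i j ∧
        ∑ i, a i * w i j ≤ hi' * (∑ i, b i * w i j) := by
  set σ := ∑ i ∈ S1, a i with hσd
  set τ := ∑ i ∈ S1, b i with hτd
  have hM0 : 0 < M := by linarith
  have hM2 : 0 < M ^ 2 := by positivity
  have hτ0 : 0 ≤ τ := Finset.sum_nonneg fun i _ => hb i
  have hlt : lo * τ ≤ σ := by
    rw [hτd, hσd, Finset.mul_sum]; exact Finset.sum_le_sum fun i _ => h1 i
  have hht : σ ≤ hi * τ := by
    rw [hτd, hσd, Finset.mul_sum]; exact Finset.sum_le_sum fun i _ => h2 i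
  have hτ : 0 < τ := by
    rcases hτ0.lt_or_eq with h | h
    · exact h
    · rw [← h] at hht; linarith
  set m := σ / τ with hm
  have hσm : σ = m * τ := by rw [hm]; field_simp
  have hm0 : 0 < m := by positivity
  have hlm : lo ≤ m := by rw [hm, le_div_iff₀ hτ]; exact hlt
  have hmh : m ≤ hi := by rw [hm, div_le_iff₀ hτ]; exact hht
  set δ := 1 / M ^ 2 with hδ
  have hδ0 : 0 < δ := by positivity
  have hδ1 : δ ≤ 1 := by
    rw [hδ, div_le_one hM2]; nlinarith
  have hδM : δ * M = 1 / M := by rw [hδ]; field_simp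
  refine ⟨lo + δ * (m - lo), hi - δ * (hi - m), ?_, ?_, ?_, ?_, ?_⟩
  · nlinarith [mul_pos hδ0 hm0, mul_nonneg hlo (sub_nonneg.2 hδ1)]
  · nlinarith
  · nlinarith
  · ring
  intro j
  by_cases hj : j ∈ S2
  swap
  · have : ∀ i, w i j = 0 := fun i => hw0 i j fun h => hj h.2
    simp [this]
  have hs : ∀ f : 𝓨 → ℝ, ∑ i, f i * w i j = ∑ i ∈ S1, f i * w i j := by
    intro f
    symm
    apply Finset.sum_subset (Finset.subset_univ _)
    intro i _ hi
    rw [hw0 i j fun h => hi h.1, mul_zero]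
  rw [hs, hs]
  have hbM : ∑ i ∈ S1, b i * w i j ≤ τ * M := by
    rw [hτd, Finset.sum_mul]
    exact Finset.sum_le_sum fun i hi => mul_le_mul_of_nonneg_left (hw1 i j hi hj).2 (hb i)
  have hA : (σ - lo * τ) * (1 / M) ≤
      ∑ i ∈ S1, a i * w i j - lo * ∑ i ∈ S1, b i * w i j := by
    rw [hτd, hσd, Finset.mul_sum, Finset.mul_sum, ← Finset.sum_sub_distrib,
      ← Finset.sum_sub_distrib, Finset.sum_mul]
    refine Finset.sum_le_sum fun i hi => ?_
    have := mul_le_mul_of_nonneg_left (hw1 i j hi hj).1 (sub_nonneg.2 (h1 i))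
    linarith
  have hB : (hi * τ - σ) * (1 / M) ≤
      hi * ∑ i ∈ S1, b i * w i j - ∑ i ∈ S1, a i * w i j := by
    rw [hτd, hσd, Finset.mul_sum, Finset.mul_sum, ← Finset.sum_sub_distrib,
      ← Finset.sum_sub_distrib, Finset.sum_mul]
    refine Finset.sum_le_sum fun i hi => ?_
    have := mul_le_mul_of_nonneg_left (hw1 i j hi hj).1 (sub_nonneg.2 (h2 i))
    linarith
  set B := ∑ i ∈ S1, b i * w i j
  set A := ∑ i ∈ S1, a i * w i j
  have e1 : δ * (m - lo) * B ≤ (σ - lo * τ) * (1 / M) := by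
    calc δ * (m - lo) * B ≤ δ * (m - lo) * (τ * M) :=
          mul_le_mul_of_nonneg_left hbM (mul_nonneg hδ0.le (sub_nonneg.2 hlm))
      _ = (m * τ - lo * τ) * (δ * M) := by ring
      _ = _ := by rw [hδM, ← hσm]
  have e2 : δ * (hi - m) * B ≤ (hi * τ - σ) * (1 / M) := by
    calc δ * (hi - m) * B ≤ δ * (hi - m) * (τ * M) :=
          mul_le_mul_of_nonneg_left hbM (mul_nonneg hδ0.le (sub_nonneg.2 hmh))
      _ = (hi * τ - m * τ) * (δ * M) := by ring
      _ = _ := by rw [hδM, ← hσm]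
  constructor <;> linarith

/-- A good block at time `t`. -/
def Gblk (q : 𝓧 × 𝓨 → 𝓧 × 𝓨 → ℝ≥0∞) (R : ℕ) (S1 S2 : Finset 𝓨) (M : ℝ) (x : ℕ → 𝓧) (t : ℕ) :
    Prop :=
  ∀ i j, (¬ (i ∈ S1 ∧ j ∈ S2) → bet q t R i x j = 0) ∧
    (i ∈ S1 → j ∈ S2 → ENNReal.ofReal (1 / M) ≤ bet q t R i x j ∧
      bet q t R i x j ≤ ENNReal.ofReal M)

variable {μ : Measure 𝓧} [SigmaFinite μ] {q : 𝓧 × 𝓨 → 𝓧 × 𝓨 → ℝ≥0∞} {p0 : 𝓧 × 𝓨 → ℝ≥0∞}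

lemma Bset_step (hq : Measurable (Function.uncurry q)) (hp : Measurable p0) {s t : ℕ}
    (hst : s ≤ t) (k : ℕ) {lo hi : ℝ≥0∞} {x : ℕ → 𝓧} (hx : x ∈ Bset μ p0 q s t lo hi) :
    x ∈ Bset μ p0 q s (t + k) lo hi := by
  intro j
  rw [alp'_bet hq hp hst, alp_bet, Finset.mul_sum, Finset.mul_sum]
  constructor
  · refine Finset.sum_le_sum fun i _ => ?_
    rw [← mul_assoc]
    gcongr
    exact (hx i).1
  · refine Finset.sum_le_sum fun i _ => ?_
    rw [← mul_assoc]
    gcongr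
    exact (hx i).2

lemma Bset_block (hq : Measurable (Function.uncurry q)) (hp : Measurable p0) {s t : ℕ}
    (hst : s ≤ t) {R : ℕ} {S1 S2 : Finset 𝓨} {M : ℝ} (hM : 1 ≤ M) {x : ℕ → 𝓧}
    (hfin : ∀ t i, alp p0 q t x i ≠ ⊤)
    (hfin' : ∀ t, s ≤ t → ∀ i, alp' μ p0 q s t x i ≠ ⊤)
    (hpos : ∀ t, ∃ i, alp p0 q t x i ≠ 0)
    (hG : Gblk q R S1 S2 M x t) {lo hi : ℝ} (hlo : 0 ≤ lo) (hhi : 0 ≤ hi)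
    (hx : x ∈ Bset μ p0 q s t (ENNReal.ofReal lo) (ENNReal.ofReal hi)) :
    ∃ lo' hi' : ℝ, 0 < lo' ∧ lo ≤ lo' ∧ lo' ≤ hi' ∧ hi' - lo' = (1 - 1 / M ^ 2) * (hi - lo) ∧
      x ∈ Bset μ p0 q s (t + R) (ENNReal.ofReal lo') (ENNReal.ofReal hi') := by
  have hM0 : 0 < M := by linarith
  have hσ : 0 < ∑ i ∈ S1, (alp p0 q t x i).toReal := by
    obtain ⟨j, hj⟩ := hpos (t + R)
    rw [alp_bet] at hj
    obtain ⟨i, -, hi⟩ := Finset.exists_ne_zero_of_sum_ne_zero hj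
    have hi1 : i ∈ S1 := by
      by_contra h
      exact hi (by rw [(hG i j).1 fun h' => h h'.1, mul_zero])
    refine Finset.sum_pos' (fun _ _ => ENNReal.toReal_nonneg) ⟨i, hi1, ?_⟩
    exact ENNReal.toReal_pos (left_ne_zero_of_mul hi) (hfin t i)
  obtain ⟨lo', hi', a1, a2, a3, a4, a5⟩ := contr_real S1 S2 (fun i => (alp p0 q t x i).toReal)
    (fun i => (alp' μ p0 q s t x i).toReal) (fun i j => (bet q t R i x j).toReal) lo hi M
    (fun _ => ENNReal.toReal_nonneg) hlo hM
    (fun i => by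
      have := ENNReal.toReal_mono (hfin t i) (hx i).1
      rwa [ENNReal.toReal_mul, ENNReal.toReal_ofReal hlo] at this)
    (fun i => by
      have := ENNReal.toReal_mono (ENNReal.mul_ne_top ENNReal.ofReal_ne_top (hfin' t hst i))
        (hx i).2
      rwa [ENNReal.toReal_mul, ENNReal.toReal_ofReal hhi] at this)
    (fun i j h => by rw [(hG i j).1 h, ENNReal.toReal_zero])
    (fun i j hi hj => by
      obtain ⟨b1, b2⟩ := (hG i j).2 hi hj
      have hne := ne_top_of_le_ne_top ENNReal.ofReal_ne_top b2
      constructor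
      · exact (ENNReal.ofReal_le_iff_le_toReal hne).1 b1
      · exact ENNReal.toReal_le_of_le_ofReal hM0.le b2) hσ
  refine ⟨lo', hi', a1, a2, a3, a4, fun j => ?_⟩
  have e1 : (alp p0 q (t + R) x j).toReal =
      ∑ i, (alp p0 q t x i).toReal * (bet q t R i x j).toReal := by
    have h := hfin (t + R) j
    rw [alp_bet] at h ⊢
    rw [ENNReal.toReal_sum fun i hi => (ENNReal.sum_ne_top.1 h) i hi]
    simp only [ENNReal.toReal_mul]
  have e2 : (alp' μ p0 q s (t + R) x j).toReal =
      ∑ i, (alp' μ p0 q s t x i).toReal * (bet q t R i x j).toReal := by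
    have h := hfin' (t + R) (by omega) j
    rw [alp'_bet hq hp hst] at h ⊢
    rw [ENNReal.toReal_sum fun i hi => (ENNReal.sum_ne_top.1 h) i hi]
    simp only [ENNReal.toReal_mul]
  have a6 := a5 j
  simp only [← e1, ← e2] at a6
  have hl' : 0 ≤ lo' := a1.le
  have hh' : 0 ≤ hi' := hl'.trans a3
  constructor
  · rw [← ENNReal.toReal_le_toReal (ENNReal.mul_ne_top ENNReal.ofReal_ne_top
      (hfin' (t + R) (by omega) j)) (hfin _ j), ENNReal.toReal_mul, ENNReal.toReal_ofReal hl']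
    exact a6.1
  · rw [← ENNReal.toReal_le_toReal (hfin _ j) (ENNReal.mul_ne_top ENNReal.ofReal_ne_top
      (hfin' (t + R) (by omega) j)), ENNReal.toReal_mul, ENNReal.toReal_ofReal hh']
    exact a6.2

lemma contraction (hq : Measurable (Function.uncurry q)) (hp : Measurable p0) {s : ℕ}
    {R : ℕ} {S1 S2 : Finset 𝓨} {M : ℝ} (hM : 1 ≤ M) {x : ℕ → 𝓧}
    (hfin : ∀ t i, alp p0 q t x i ≠ ⊤)
    (hfin' : ∀ t, s ≤ t → ∀ i, alp' μ p0 q s t x i ≠ ⊤)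
    (hpos : ∀ t, ∃ i, alp p0 q t x i ≠ 0)
    (hsupp : ∀ i, alp' μ p0 q s s x i = 0 → alp p0 q s x i = 0)
    (hG : ∀ N, ∃ t, N ≤ t ∧ Gblk q R S1 S2 M x t) {ε : ℝ} (hε : 0 < ε) :
    ∃ lo hi : ℝ, 0 < lo ∧ lo ≤ hi ∧ hi < (1 + ε) * lo ∧
      ∃ T, ∀ t, T ≤ t → x ∈ Bset μ p0 q s t (ENNReal.ofReal lo) (ENNReal.ofReal hi) := by
  set δ := 1 / M ^ 2 with hδ
  have hδ0 : 0 < δ := by positivity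
  have hδ1 : δ ≤ 1 := by
    rw [hδ, div_le_one (by positivity)]; nlinarith
  -- one block
  have step : ∀ (T : ℕ) (lo hi : ℝ), s ≤ T → 0 ≤ lo → 0 ≤ hi →
      x ∈ Bset μ p0 q s T (ENNReal.ofReal lo) (ENNReal.ofReal hi) →
      ∃ T' lo' hi', s ≤ T' ∧ 0 < lo' ∧ lo ≤ lo' ∧ lo' ≤ hi' ∧
        hi' - lo' = (1 - δ) * (hi - lo) ∧
        x ∈ Bset μ p0 q s T' (ENNReal.ofReal lo') (ENNReal.ofReal hi') := by
    intro T lo hi hT h1 h2 h3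
    obtain ⟨t, htT, ht⟩ := hG T
    have h4 : x ∈ Bset μ p0 q s t (ENNReal.ofReal lo) (ENNReal.ofReal hi) := by
      have := Bset_step hq hp hT (t - T) h3
      rwa [Nat.add_sub_cancel' htT] at this
    obtain ⟨lo', hi', b1, b2, b3, b4, b5⟩ :=
      Bset_block hq hp (hT.trans htT) hM hfin hfin' hpos ht h1 h2 h4
    exact ⟨t + R, lo', hi', by omega, b1, b2, b3, b4, b5⟩
  -- initial bound
  have init : ∃ hi0 : ℝ, 0 ≤ hi0 ∧
      x ∈ Bset μ p0 q s s (ENNReal.ofReal 0) (ENNReal.ofReal hi0) := by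
    refine ⟨∑ i, (alp p0 q s x i / alp' μ p0 q s s x i).toReal,
      Finset.sum_nonneg fun _ _ => ENNReal.toReal_nonneg, fun i => ⟨by simp, ?_⟩⟩
    by_cases h0 : alp' μ p0 q s s x i = 0
    · rw [hsupp i h0]; exact zero_le
    · have hne : alp p0 q s x i / alp' μ p0 q s s x i ≠ ⊤ := ENNReal.div_ne_top (hfin s i) h0
      calc alp p0 q s x i = alp p0 q s x i / alp' μ p0 q s s x i * alp' μ p0 q s s x i :=
            (ENNReal.div_mul_cancel h0 (hfin' s le_rfl i)).symm
        _ ≤ _ := by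
          gcongr
          rw [← ENNReal.ofReal_toReal hne]
          apply ENNReal.ofReal_le_ofReal
          exact Finset.single_le_sum (f := fun i => (alp p0 q s x i / alp' μ p0 q s s x i).toReal)
            (fun _ _ => ENNReal.toReal_nonneg) (Finset.mem_univ i)
  obtain ⟨hi0, c0, c1⟩ := init
  obtain ⟨T1, lo1, hi1, d1, d2, d3, d4, d5, d6⟩ := step s 0 hi0 le_rfl le_rfl c0 c1
  have iter : ∀ n : ℕ, ∃ T lo hi, s ≤ T ∧ lo1 ≤ lo ∧ lo ≤ hi ∧
      hi - lo = (1 - δ) ^ n * (hi1 - lo1) ∧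
        x ∈ Bset μ p0 q s T (ENNReal.ofReal lo) (ENNReal.ofReal hi) := by
    intro n
    induction n with
    | zero => exact ⟨T1, lo1, hi1, d1, le_rfl, d4, by simp, d6⟩
    | succ n ih =>
      obtain ⟨T, lo, hi, e1, e2, e3, e4, e5⟩ := ih
      obtain ⟨T', lo', hi', f1, f2, f3, f4, f5, f6⟩ :=
        step T lo hi e1 (by linarith) (by linarith) e5
      exact ⟨T', lo', hi', f1, e2.trans f3, f4, by rw [f5, e4]; ring, f6⟩
  have hlim : Filter.Tendsto (fun n : ℕ => (1 - δ) ^ n * (hi1 - lo1)) Filter.atTop (nhds 0) := by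
    have := (tendsto_pow_atTop_nhds_zero_of_lt_one (r := 1 - δ) (by linarith)
      (by linarith)).mul_const (hi1 - lo1)
    simpa using this
  obtain ⟨n, hn⟩ := (hlim.eventually (gt_mem_nhds (mul_pos hε d2))).exists
  obtain ⟨T, lo, hi, e1, e2, e3, e4, e5⟩ := iter n
  refine ⟨lo, hi, by linarith, e3, ?_, T, fun t ht => ?_⟩
  · have : ε * lo1 ≤ ε * lo := mul_le_mul_of_nonneg_left e2 hε.le
    rw [← e4] at hn
    linarith
  · have := Bset_step hq hp e1 (t - T) e5
    rwa [Nat.add_sub_cancel' ht] at this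

end Contraction

section Blocks

/-- the window of length `R+1` starting at `N` -/
def win (R N : ℕ) (x : ℕ → 𝓧) : Fin (R + 1) → 𝓧 := fun k => x (N + (k : ℕ))

lemma measurable_win (R N : ℕ) : Measurable (win R N : (ℕ → 𝓧) → _) :=
  measurable_pi_lambda _ fun _ => measurable_pi_apply _

lemma lmarg_win (μ : Measure 𝓧) [SigmaFinite μ] (R N : ℕ) (g : (Fin (R + 1) → 𝓧) → ℝ≥0∞)
    (x : ℕ → 𝓧) :
    lmarginal (fun _ => μ) (Finset.Ioc N (N + R)) (fun x => g (win R N x)) x =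
      ∫⁻ v : Fin R → 𝓧, g (Fin.cons (x N) v) ∂(Measure.pi fun _ => μ) := by
  let e : Fin R ≃ Finset.Ioc N (N + R) :=
    { toFun := fun k => ⟨N + k + 1, Finset.mem_Ioc.2 (by have := k.2; omega)⟩
      invFun := fun a => ⟨a.1 - N - 1, by have := Finset.mem_Ioc.1 a.2; omega⟩
      left_inv := fun k => by ext; simp; omega
      right_inv := fun a => by
        ext; have := Finset.mem_Ioc.1 a.2; simp; omega }
  have hmp := measurePreserving_piCongrLeft (α := fun _ : Finset.Ioc N (N + R) => 𝓧)
    (fun _ => μ) e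
  rw [lmarginal, ← hmp.lintegral_comp_emb (MeasurableEquiv.measurableEmbedding _)]
  refine lintegral_congr fun v => ?_
  congr 1
  funext k
  refine Fin.cases ?_ (fun k => ?_) k
  · simp [win, Function.updateFinset]
  · have h1 : N + (k.succ : ℕ) ∈ Finset.Ioc N (N + R) := by
      have := k.2
      rw [Finset.mem_Ioc, Fin.val_succ]
      omega
    simp only [win, Function.updateFinset, h1, dif_pos, Fin.cons_succ]
    have h2 : (⟨N + (k.succ : ℕ), h1⟩ : Finset.Ioc N (N + R)) = e k := by
      ext; simp [e, add_assoc]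
    rw [h2, MeasurableEquiv.coe_piCongrLeft]
    exact Equiv.piCongrLeft_apply_apply (fun _ : Finset.Ioc N (N + R) => 𝓧) e v k

lemma measurable_pijD {q : 𝓧 × 𝓨 → 𝓧 × 𝓨 → ℝ≥0∞} (hq : Measurable (Function.uncurry q))
    {R : ℕ} (i j : 𝓨) : Measurable (fun u : Fin (R + 1) → 𝓧 => pijD q u i j) := by
  refine Finset.measurable_sum _ fun y _ => ?_
  by_cases h : y 0 = i ∧ y (Fin.last R) = j
  · simp only [h, and_self, if_true]
    refine Finset.measurable_prod _ fun k _ => measurable_q hq ?_ ?_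
    · exact (measurable_pi_apply _).prodMk measurable_const
    · exact (measurable_pi_apply _).prodMk measurable_const
  · simp only [h, if_false]
    exact measurable_const

lemma measurable_cons (R : ℕ) (x : 𝓧) :
    Measurable (fun v : Fin R → 𝓧 => (Fin.cons x v : Fin (R + 1) → 𝓧)) := by
  refine measurable_pi_lambda _ fun k => ?_
  refine Fin.cases ?_ (fun k => ?_) k
  · simp
  · simpa using measurable_pi_apply k

lemma measurable_cons' (R : ℕ) :
    Measurable (fun p : 𝓧 × (Fin R → 𝓧) => (Fin.cons p.1 p.2 : Fin (R + 1) → 𝓧)) := by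
  refine measurable_pi_lambda _ fun k => ?_
  refine Fin.cases ?_ (fun k => ?_) k
  · simpa using measurable_fst
  · simp only [Fin.cons_succ]
    exact (measurable_pi_apply k).comp measurable_snd

/-- conditional probability of a `G`-block starting from `z` -/
noncomputable def blk (μ : Measure 𝓧) (q : 𝓧 × 𝓨 → 𝓧 × 𝓨 → ℝ≥0∞) {R : ℕ}
    (G : Set (Fin (R + 1) → 𝓧)) (z : 𝓧 × 𝓨) : ℝ≥0∞ :=
  ∑ j, ∫⁻ v : Fin R → 𝓧, G.indicator (fun _ => 1) (Fin.cons z.1 v : Fin (R + 1) → 𝓧) *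
    pijD q (Fin.cons z.1 v : Fin (R + 1) → 𝓧) z.2 j ∂(Measure.pi fun _ => μ)

lemma measurable_blk {μ : Measure 𝓧} [SigmaFinite μ] {q : 𝓧 × 𝓨 → 𝓧 × 𝓨 → ℝ≥0∞}
    (hq : Measurable (Function.uncurry q)) {R : ℕ} {G : Set (Fin (R + 1) → 𝓧)}
    (hG : MeasurableSet G) : Measurable (blk μ q G) := by
  refine measurable_from_prod_countable_left fun i => ?_
  refine Finset.measurable_sum _ fun j _ => ?_
  have h : Measurable (fun u : Fin (R + 1) → 𝓧 =>
      G.indicator (fun _ => (1 : ℝ≥0∞)) u * pijD q u i j) :=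
    (measurable_const.indicator hG).mul (measurable_pijD hq i j)
  exact Measurable.lintegral_prod_right' (h.comp (measurable_cons' R))

lemma blk_formula {P : Measure Ω} [IsFiniteMeasure P] {Z : ℕ → Ω → 𝓧 × 𝓨}
    {κ : Kernel (𝓧 × 𝓨) (𝓧 × 𝓨)} [IsMarkovKernel κ] (h : IsMarkovChain P Z κ)
    {μ : Measure 𝓧} [SigmaFinite μ] {q : 𝓧 × 𝓨 → 𝓧 × 𝓨 → ℝ≥0∞}
    (hq : Measurable (Function.uncurry q))
    (hκ : ∀ z : 𝓧 × 𝓨, (κ z : Measure (𝓧 × 𝓨)) =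
      (μ.prod Measure.count).withDensity (fun z' => q z' z))
    (N : ℕ) {C : Set Ω} (hC : MeasurableSet[hist Z N] C) {R : ℕ}
    {G : Set (Fin (R + 1) → 𝓧)} (hG : MeasurableSet G) :
    ∫⁻ ω in C, G.indicator (fun _ => 1) (win R N (xp Z ω)) ∂P = ∫⁻ ω in C, blk μ q G (Z N ω) ∂P := by
  have := block_formula h hq hκ N hC R (fun x _ => G.indicator (fun _ => 1) (win R N x))
    (fun _ => (measurable_const.indicator hG).comp (measurable_win R N))
    (fun _ x y hxy => by
      have : win R N x = win R N y := by
        funext k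
        have := k.2
        exact hxy _ (by simp; omega)
      simp only [this])
  rw [this]
  refine lintegral_congr fun ω => ?_
  simp only [blk]
  refine Finset.sum_congr rfl fun j _ => ?_
  simp only [bet_pijD]
  exact lmarg_win μ R N (fun u => G.indicator (fun _ => 1) u * pijD q u (Z N ω).2 j) (xp Z ω)

variable [MeasurableSingletonClass 𝓧]

lemma blk_univ {κ : Kernel (𝓧 × 𝓨) (𝓧 × 𝓨)} {Pz : 𝓧 × 𝓨 → Measure (ℕ → 𝓧 × 𝓨)}
    (hF : IsMarkovFamily κ Pz)
    {μ : Measure 𝓧} [SigmaFinite μ] {q : 𝓧 × 𝓨 → 𝓧 × 𝓨 → ℝ≥0∞}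
    (hq : Measurable (Function.uncurry q))
    (hκ : ∀ z : 𝓧 × 𝓨, (κ z : Measure (𝓧 × 𝓨)) =
      (μ.prod Measure.count).withDensity (fun z' => q z' z)) (R : ℕ) (z : 𝓧 × 𝓨) :
    blk μ q (Set.univ : Set (Fin (R + 1) → 𝓧)) z = 1 := by
  have := family_markov hF
  have := hF.1 z
  have h := blk_formula (family_chain hF z) hq hκ 0 (C := Set.univ) MeasurableSet.univ
    (R := R) MeasurableSet.univ
  have h0 : ∀ᵐ ω ∂(Pz z), blk μ q (Set.univ : Set (Fin (R + 1) → 𝓧)) (ω 0) =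
      blk μ q (Set.univ : Set (Fin (R + 1) → 𝓧)) z := by
    filter_upwards [family_start hF z] with ω hω using by rw [hω]
  rw [Measure.restrict_univ, lintegral_congr_ae h0] at h
  simpa using h.symm

lemma blk_mono {μ : Measure 𝓧} {q : 𝓧 × 𝓨 → 𝓧 × 𝓨 → ℝ≥0∞} {R : ℕ}
    {G G' : Set (Fin (R + 1) → 𝓧)} (h : G ⊆ G') (z : 𝓧 × 𝓨) : blk μ q G z ≤ blk μ q G' z := by
  refine Finset.sum_le_sum fun j _ => lintegral_mono fun v => ?_
  have := Set.indicator_le_indicator_of_subset h (f := fun _ : Fin (R + 1) → 𝓧 => (1 : ℝ≥0∞))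
    (fun _ => zero_le) (Fin.cons z.1 v)
  exact mul_le_mul_left this _

/-- good windows -/
def GF (q : 𝓧 × 𝓨 → 𝓧 × 𝓨 → ℝ≥0∞) (R : ℕ) (S1 S2 : Finset 𝓨) (M : ℝ) :
    Set (Fin (R + 1) → 𝓧) :=
  {u | ∀ i j, (¬ (i ∈ S1 ∧ j ∈ S2) → pijD q u i j = 0) ∧
    (i ∈ S1 → j ∈ S2 → ENNReal.ofReal (1 / M) ≤ pijD q u i j ∧
      pijD q u i j ≤ ENNReal.ofReal M)}

lemma Gblk_iff (q : 𝓧 × 𝓨 → 𝓧 × 𝓨 → ℝ≥0∞) (R : ℕ) (S1 S2 : Finset 𝓨) (M : ℝ) (x : ℕ → 𝓧)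
    (t : ℕ) : Gblk q R S1 S2 M x t ↔ win R t x ∈ GF q R S1 S2 M := by
  simp only [Gblk, bet_pijD]
  rfl

lemma measurableSet_GF {q : 𝓧 × 𝓨 → 𝓧 × 𝓨 → ℝ≥0∞} (hq : Measurable (Function.uncurry q))
    (R : ℕ) (S1 S2 : Finset 𝓨) (M : ℝ) : MeasurableSet (GF q R S1 S2 M) := by
  have hp := fun i j => measurable_pijD hq (R := R) i j
  have : GF q R S1 S2 M = ⋂ i, ⋂ j,
      {u | ¬ (i ∈ S1 ∧ j ∈ S2) → pijD q u i j = 0} ∩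
      {u | i ∈ S1 → j ∈ S2 → ENNReal.ofReal (1 / M) ≤ pijD q u i j ∧
      pijD q u i j ≤ ENNReal.ofReal M} := by
    ext u; simp [GF]
  rw [this]
  refine MeasurableSet.iInter fun i => MeasurableSet.iInter fun j => MeasurableSet.inter ?_ ?_
  · by_cases h : i ∈ S1 ∧ j ∈ S2
    · simp [h]
    · simp only [h, not_false_eq_true, forall_const]
      exact hp i j (measurableSet_singleton 0)
  · by_cases h : i ∈ S1 ∧ j ∈ S2
    · simp only [h.1, h.2, forall_const]
      exact (measurableSet_le measurable_const (hp i j)).inter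
        (measurableSet_le (hp i j) measurable_const)
    · have : ∀ u : Fin (R + 1) → 𝓧, (i ∈ S1 → j ∈ S2 → ENNReal.ofReal (1 / M) ≤ pijD q u i j ∧
        pijD q u i j ≤ ENNReal.ofReal M) := fun u h1 h2 => absurd ⟨h1, h2⟩ h
      rw [Set.eq_univ_of_forall (s := {u | i ∈ S1 → j ∈ S2 → ENNReal.ofReal (1 / M) ≤ pijD q u i j ∧
        pijD q u i j ≤ ENNReal.ofReal M}) this]
      exact MeasurableSet.univ

lemma GF_mono (q : 𝓧 × 𝓨 → 𝓧 × 𝓨 → ℝ≥0∞) (R : ℕ) (S1 S2 : Finset 𝓨) {M M' : ℝ} (hM : 0 < M)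
    (h : M ≤ M') : GF q R S1 S2 M ⊆ GF q R S1 S2 M' := by
  intro u hu i j
  refine ⟨(hu i j).1, fun h1 h2 => ?_⟩
  obtain ⟨a, b⟩ := (hu i j).2 h1 h2
  refine ⟨le_trans (ENNReal.ofReal_le_ofReal ?_) a, b.trans (ENNReal.ofReal_le_ofReal h)⟩
  exact one_div_le_one_div_of_le hM h

lemma exists_GF {q : 𝓧 × 𝓨 → 𝓧 × 𝓨 → ℝ≥0∞} {R : ℕ} {S1 S2 : Finset 𝓨}
    {u : Fin (R + 1) → 𝓧} (hfin : ∀ i j, pijD q u i j ≠ ⊤)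
    (h : ∀ i j, pijD q u i j ≠ 0 ↔ i ∈ S1 ∧ j ∈ S2) :
    ∃ n : ℕ, u ∈ GF q R S1 S2 ((n : ℝ) + 1) := by
  obtain ⟨n, hn⟩ := exists_nat_ge
    (∑ i, ∑ j, ((pijD q u i j).toReal + ((pijD q u i j).toReal)⁻¹))
  refine ⟨n, fun i j => ⟨fun hij => by_contra fun h' => hij ((h i j).1 h'), fun h1 h2 => ?_⟩⟩
  have hp : 0 < (pijD q u i j).toReal := ENNReal.toReal_pos ((h i j).2 ⟨h1, h2⟩) (hfin i j)
  have hle : (pijD q u i j).toReal + ((pijD q u i j).toReal)⁻¹ ≤ n := by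
    refine le_trans ?_ hn
    have hnn : ∀ i j, 0 ≤ (pijD q u i j).toReal + ((pijD q u i j).toReal)⁻¹ := fun i j => by
      positivity
    refine le_trans ?_ (Finset.single_le_sum
      (f := fun i => ∑ j, ((pijD q u i j).toReal + ((pijD q u i j).toReal)⁻¹))
      (fun i _ => Finset.sum_nonneg fun j _ => hnn i j) (Finset.mem_univ i))
    exact Finset.single_le_sum
      (f := fun j => ((pijD q u i j).toReal + ((pijD q u i j).toReal)⁻¹))
      (fun j _ => hnn i j) (Finset.mem_univ j)
  have hinv : 0 < ((pijD q u i j).toReal)⁻¹ := by positivity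
  constructor
  · rw [ENNReal.ofReal_le_iff_le_toReal (hfin i j), one_div]
    exact inv_le_of_inv_le₀ hp (by linarith)
  · rw [← ENNReal.ofReal_toReal (hfin i j)]
    exact ENNReal.ofReal_le_ofReal (by linarith)

/-- start set -/
def Ast (μ : Measure 𝓧) (q : 𝓧 × 𝓨 → 𝓧 × 𝓨 → ℝ≥0∞) (R : ℕ) (S1 S2 : Finset 𝓨) (n : ℕ) :
    Set (𝓧 × 𝓨) :=
  {z | ENNReal.ofReal (1 / ((n : ℝ) + 1)) < blk μ q (GF q R S1 S2 ((n : ℝ) + 1)) z}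

lemma start_subset {κ : Kernel (𝓧 × 𝓨) (𝓧 × 𝓨)} {Pz : 𝓧 × 𝓨 → Measure (ℕ → 𝓧 × 𝓨)}
    (hF : IsMarkovFamily κ Pz)
    {μ : Measure 𝓧} [SigmaFinite μ] {q : 𝓧 × 𝓨 → 𝓧 × 𝓨 → ℝ≥0∞}
    (hq : Measurable (Function.uncurry q))
    (hκ : ∀ z : 𝓧 × 𝓨, (κ z : Measure (𝓧 × 𝓨)) =
      (μ.prod Measure.count).withDensity (fun z' => q z' z)) {R : ℕ}
    {E : Set (Fin (R + 1) → 𝓧)} {S1 S2 : Finset 𝓨}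
    (hE : ∀ u ∈ E, ∀ i j, pijD q u i j ≠ 0 ↔ i ∈ S1 ∧ j ∈ S2) (hS2 : S2.Nonempty)
    {z : 𝓧 × 𝓨} (hz : z.2 ∈ S1)
    (hpos : 0 < (Measure.pi fun _ : Fin R => μ) (secSet E z.1)) :
    ∃ n, z ∈ Ast μ q R S1 S2 n := by
  by_contra hcon
  push Not at hcon
  have hz0 : ∀ n : ℕ, blk μ q (GF q R S1 S2 ((n : ℝ) + 1)) z = 0 := by
    intro n
    have hle : ∀ k : ℕ, n ≤ k → blk μ q (GF q R S1 S2 ((n : ℝ) + 1)) z ≤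
        ENNReal.ofReal (1 / ((k : ℝ) + 1)) := by
      intro k hk
      refine (blk_mono (GF_mono q R S1 S2 (by positivity) ?_) z).trans (not_lt.1 (hcon k))
      have : (n : ℝ) ≤ k := by exact_mod_cast hk
      linarith
    have hlim : Filter.Tendsto (fun k : ℕ => ENNReal.ofReal (1 / ((k : ℝ) + 1))) Filter.atTop
        (nhds 0) := by
      have := ENNReal.tendsto_ofReal (tendsto_one_div_add_atTop_nhds_zero_nat (𝕜 := ℝ))
      simpa using this
    have := ge_of_tendsto hlim (Filter.eventually_atTop.2 ⟨n, fun k hk => hle k hk⟩)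
    exact le_antisymm this zero_le
  have hm : ∀ i j, Measurable (fun v : Fin R → 𝓧 =>
      pijD q (Fin.cons z.1 v : Fin (R + 1) → 𝓧) i j) := fun i j =>
    (measurable_pijD hq i j).comp (measurable_cons R z.1)
  have hfin : ∀ᵐ v ∂(Measure.pi fun _ : Fin R => μ), ∀ i j,
      pijD q (Fin.cons z.1 v : Fin (R + 1) → 𝓧) i j < ⊤ := by
    rw [ae_all_iff]; intro i; rw [ae_all_iff]; intro j
    refine ae_lt_top (hm i j) ?_
    have h1 := blk_univ hF hq hκ R (z.1, i)
    simp only [blk, Set.indicator_univ, one_mul] at h1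
    have h2 := ENNReal.sum_ne_top.1 (h1.trans_ne ENNReal.one_ne_top) j (Finset.mem_univ j)
    exact h2
  have hnull : ∀ᵐ v ∂(Measure.pi fun _ : Fin R => μ), ∀ n : ℕ, ∀ j,
      (GF q R S1 S2 ((n : ℝ) + 1)).indicator (fun _ => (1 : ℝ≥0∞))
        (Fin.cons z.1 v : Fin (R + 1) → 𝓧) *
      pijD q (Fin.cons z.1 v : Fin (R + 1) → 𝓧) z.2 j = 0 := by
    rw [ae_all_iff]; intro n; rw [ae_all_iff]; intro j
    have h1 := hz0 n
    simp only [blk, Finset.sum_eq_zero_iff, Finset.mem_univ, forall_const] at h1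
    have h2 := h1 j
    rw [lintegral_eq_zero_iff] at h2
    · exact h2
    · exact ((measurable_const.indicator (measurableSet_GF hq R S1 S2 _)).comp
        (measurable_cons R z.1)).mul (hm z.2 j)
  have : ∀ᵐ v ∂(Measure.pi fun _ : Fin R => μ), v ∉ secSet E z.1 := by
    filter_upwards [hfin, hnull] with v h1 h2 hv
    obtain ⟨n, hn⟩ := exists_GF (fun i j => (h1 i j).ne) (hE _ hv)
    obtain ⟨j, hj⟩ := hS2
    have h3 := h2 n j
    rw [Set.indicator_of_mem hn, one_mul] at h3
    exact (hE _ hv z.2 j).2 ⟨hz, hj⟩ h3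
  exact hpos.ne' (measure_eq_zero_iff_ae_notMem.2 this)

lemma blocks_io {κ : Kernel (𝓧 × 𝓨) (𝓧 × 𝓨)} {Pz : 𝓧 × 𝓨 → Measure (ℕ → 𝓧 × 𝓨)}
    (hF : IsMarkovFamily κ Pz)
    {μ : Measure 𝓧} [SigmaFinite μ] {q : 𝓧 × 𝓨 → 𝓧 × 𝓨 → ℝ≥0∞}
    (hq : Measurable (Function.uncurry q))
    (hκ : ∀ z : 𝓧 × 𝓨, (κ z : Measure (𝓧 × 𝓨)) =
      (μ.prod Measure.count).withDensity (fun z' => q z' z)) {R : ℕ}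
    {P : Measure Ω} [IsProbabilityMeasure P] {Z : ℕ → Ω → 𝓧 × 𝓨} (h : IsMarkovChain P Z κ)
    {G : Set (Fin (R + 1) → 𝓧)} (hG : MeasurableSet G) {c : ℝ} (hc : 0 < c)
    (hio : ∀ᵐ ω ∂P, ∀ N, ∃ k, N ≤ k ∧ ENNReal.ofReal c < blk μ q G (Z k ω)) :
    ∀ᵐ ω ∂P, ∀ N, ∃ k, N ≤ k ∧ win R k (xp Z ω) ∈ G := by
  have := family_markov hF
  rw [ae_all_iff]
  intro N
  let ℱ : Filtration ℕ ‹MeasurableSpace Ω› :=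
    ⟨hist Z, fun a b hab => hist_mono Z hab, fun k => hist_le h.1 k⟩
  let B : ℕ → Set Ω := fun k => {ω | win R k (xp Z ω) ∈ G}
  have hBm : ∀ k, MeasurableSet[hist Z (k + R)] (B k) := by
    intro k
    have : Measurable[hist Z (k + R)] (fun ω => win R k (xp Z ω)) := by
      refine @measurable_pi_lambda _ _ _ (_) _ _ (fun i => ?_)
      have hi := i.2
      exact measurable_fst.comp (measurable_hist Z (i := k + (i : ℕ)) (by omega))
    exact this hG
  have hBm' : ∀ k, MeasurableSet (B k) := fun k => hist_le h.1 _ _ (hBm k)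
  let U : Set Ω := ⋃ k ∈ Set.Ici N, B k
  have hUm : MeasurableSet[⨆ k, ℱ k] U := by
    refine MeasurableSet.iUnion fun k => MeasurableSet.iUnion fun _ => ?_
    exact le_iSup (fun k => (ℱ k : MeasurableSpace Ω)) (k + R) _ (hBm k)
  have hUm' : MeasurableSet U := MeasurableSet.iUnion fun k => MeasurableSet.iUnion fun _ => hBm' k
  let f : Ω → ℝ := U.indicator (fun _ => 1)
  have hfi : Integrable f P := (integrable_const (1 : ℝ)).indicator hUm'
  have hlim := hfi.tendsto_ae_condExp (ℱ := ℱ) (stronglyMeasurable_const.indicator hUm)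
  have hb1 : ∀ z, blk μ q G z ≤ 1 := fun z =>
    (blk_mono (Set.subset_univ _) z).trans (blk_univ hF hq hκ R z).le
  have hcond : ∀ᵐ ω ∂P, ∀ k, N ≤ k → (blk μ q G (Z k ω)).toReal ≤ (P[f | ℱ k]) ω := by
    rw [ae_all_iff]
    intro k
    by_cases hk : N ≤ k
    swap
    · exact ae_of_all _ fun ω h' => absurd h' hk
    have hbi : Integrable ((B k).indicator (fun _ => (1 : ℝ))) P :=
      (integrable_const (1 : ℝ)).indicator (hBm' k)
    have hbm : Measurable[hist Z k] (fun ω => (blk μ q G (Z k ω)).toReal) :=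
      ((measurable_blk hq hG).comp (measurable_hist Z le_rfl)).ennreal_toReal
    have hbm' : Measurable (fun ω => blk μ q G (Z k ω)) := (measurable_blk hq hG).comp (h.1 k)
    have hgi : Integrable (fun ω => (blk μ q G (Z k ω)).toReal) P := by
      refine Integrable.of_bound hbm'.ennreal_toReal.aestronglyMeasurable 1 (ae_of_all _ fun ω => ?_)
      rw [Real.norm_of_nonneg ENNReal.toReal_nonneg]
      exact ENNReal.toReal_le_of_le_ofReal zero_le_one (by simpa using hb1 (Z k ω))
    have heq : (fun ω => (blk μ q G (Z k ω)).toReal) =ᵐ[P]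
        P[(B k).indicator (fun _ => (1 : ℝ)) | ℱ k] := by
      refine ae_eq_condExp_of_forall_setIntegral_eq (ℱ.le k) hbi
        (fun s _ _ => hgi.integrableOn) (fun s hs _ => ?_)
        hbm.stronglyMeasurable.aestronglyMeasurable
      rw [integral_toReal hbm'.aemeasurable
        (ae_of_all _ fun ω => (hb1 _).trans_lt ENNReal.one_lt_top),
        ← blk_formula h hq hκ k hs hG]
      have e : ∀ ω, (B k).indicator (fun _ => (1 : ℝ)) ω =
          (G.indicator (fun _ => (1 : ℝ≥0∞)) (win R k (xp Z ω))).toReal := by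
        intro ω
        by_cases hω : win R k (xp Z ω) ∈ G
        · rw [Set.indicator_of_mem hω, Set.indicator_of_mem (show ω ∈ B k from hω)]; simp
        · rw [Set.indicator_of_notMem hω, Set.indicator_of_notMem (show ω ∉ B k from hω)]; simp
      simp_rw [e]
      rw [integral_toReal]
      · exact ((measurable_const.indicator hG).comp
          ((measurable_win R k).comp (measurable_xp h.1))).aemeasurable
      · refine ae_of_all _ fun ω => ?_
        exact (Set.indicator_le_self' (fun _ _ => zero_le) _).trans_lt ENNReal.one_lt_top
    have hmono : P[(B k).indicator (fun _ => (1 : ℝ)) | ℱ k] ≤ᵐ[P] P[f | ℱ k] := by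
      refine condExp_mono hbi hfi (ae_of_all _ fun ω => ?_)
      refine Set.indicator_le_indicator_of_subset ?_ (fun _ => zero_le_one) ω
      exact Set.subset_biUnion_of_mem (u := B) (show k ∈ Set.Ici N from hk)
    filter_upwards [heq, hmono] with ω h1 h2 _
    rw [h1]
    exact h2
  filter_upwards [hio, hlim, hcond] with ω h1 h2 h3
  by_contra hcon
  push Not at hcon
  have hωU : ω ∉ U := by
    simp only [U, Set.mem_iUnion, not_exists]
    exact fun k hk => hcon k hk
  have hf0 : f ω = 0 := Set.indicator_of_notMem hωU _
  rw [hf0] at h2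
  obtain ⟨K, hK⟩ := Filter.eventually_atTop.1 (h2.eventually (gt_mem_nhds hc))
  obtain ⟨k, hk, hk'⟩ := h1 (max N K)
  have a1 := hK k (le_trans (le_max_right _ _) hk)
  have a2 := h3 k (le_trans (le_max_left _ _) hk)
  have a3 : c < (blk μ q G (Z k ω)).toReal := by
    rwa [← ENNReal.ofReal_lt_iff_lt_toReal hc.le ((hb1 _).trans_lt ENNReal.one_lt_top).ne]
  linarith

lemma good_blocks {P : Measure Ω} {Z : ℕ → Ω → 𝓧 × 𝓨} {κ : Kernel (𝓧 × 𝓨) (𝓧 × 𝓨)}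
    {μ : Measure 𝓧} {q : 𝓧 × 𝓨 → 𝓧 × 𝓨 → ℝ≥0∞} {p0 : 𝓧 × 𝓨 → ℝ≥0∞}
    {Pz : 𝓧 × 𝓨 → Measure (ℕ → 𝓧 × 𝓨)} {ψ : Measure (𝓧 × 𝓨)}
    {R : ℕ} {E : Set (Fin (R + 1) → 𝓧)} {Yp : Set (𝓨 × 𝓨)}
    (hPMM : IsPMM P Z κ μ q p0)
    (hA1 : Assumption1 q E Yp) (hA2 : Assumption2 κ ψ μ E Yp)
    (hFam : IsMarkovFamily κ Pz) (hHarris : HarrisProp κ Pz ψ) :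
    ∃ (S1 S2 : Finset 𝓨) (M : ℝ), 1 ≤ M ∧
      ∀ᵐ ω ∂P, ∀ N, ∃ t, N ≤ t ∧ Gblk q R S1 S2 M (xp Z ω) t := by
  classical
  obtain ⟨h1, h2, h3, h4, h5, h6, h7⟩ := hPMM
  obtain ⟨b1, b2, b3, b4⟩ := hA1
  obtain ⟨c1, c2, c3⟩ := hA2
  let S1 : Finset 𝓨 := Finset.univ.filter (fun i => i ∈ Prod.fst '' Yp)
  let S2 : Finset 𝓨 := Finset.univ.filter (fun i => i ∈ Prod.snd '' Yp)
  have hS1 : ∀ i, i ∈ S1 ↔ i ∈ Prod.fst '' Yp := fun i => by simp only [S1, Finset.mem_filter, Finset.mem_univ, true_and]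
  have hS2 : ∀ i, i ∈ S2 ↔ i ∈ Prod.snd '' Yp := fun i => by simp only [S2, Finset.mem_filter, Finset.mem_univ, true_and]
  have hE : ∀ u ∈ E, ∀ i j, pijD q u i j ≠ 0 ↔ i ∈ S1 ∧ j ∈ S2 := by
    intro u hu i j
    rw [hS1, hS2, ← Set.mem_prod (p := (i, j)), ← b4, ← b3 u hu]
    exact pos_iff_ne_zero.symm
  have hS2n : S2.Nonempty := by
    obtain ⟨p, hp⟩ := b2
    exact ⟨p.2, (hS2 _).2 ⟨p, hp, rfl⟩⟩
  have hsub : proj1 E ×ˢ (Prod.fst '' Yp) ⊆ ⋃ n, Ast μ q R S1 S2 n := by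
    rintro z ⟨hz1, hz2⟩
    exact Set.mem_iUnion.2 (start_subset hFam h4 h6 hE hS2n ((hS1 _).2 hz2) (c3 z.1 hz1))
  obtain ⟨n, hn⟩ := exists_measure_pos_of_not_measure_iUnion_null
    (c2.trans_le (measure_mono hsub)).ne'
  have hAm : MeasurableSet (Ast μ q R S1 S2 n) :=
    measurableSet_lt measurable_const (measurable_blk h4 (measurableSet_GF h4 R S1 S2 _))
  have hio := chain_io hFam hHarris hAm hn h2
  refine ⟨S1, S2, (n : ℝ) + 1, by linarith [(Nat.cast_nonneg n : (0 : ℝ) ≤ n)], ?_⟩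
  have := blocks_io hFam h4 h6 h2 (measurableSet_GF h4 R S1 S2 ((n : ℝ) + 1))
    (c := 1 / ((n : ℝ) + 1)) (by positivity) hio
  filter_upwards [this] with ω hω N
  obtain ⟨k, hk, hk'⟩ := hω N
  exact ⟨k, hk, (Gblk_iff q R S1 S2 _ _ _).2 hk'⟩

end Blocks

section Final

lemma smooth_sum {P : Measure Ω} [IsProbabilityMeasure P] {Z : ℕ → Ω → 𝓧 × 𝓨}
    (hZ : ∀ k, Measurable (Z k)) (t l n m : ℕ) :
    ∀ᵐ ω ∂P, ∑ v : Fin m → 𝓨, smooth P Z t l n v ω = 1 := by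
  have h1 := condExp_finset_sum (μ := P) (s := (Finset.univ : Finset (Fin m → 𝓨)))
    (f := fun v => (Aev Z t v).indicator (fun _ => (1 : ℝ)))
    (fun v _ => integrable_Aev hZ t v) (obsSigma Z l n)
  have h2 : (∑ v : Fin m → 𝓨, (Aev Z t v).indicator (fun _ => (1 : ℝ))) = fun _ => (1 : ℝ) := by
    funext ω
    rw [Finset.sum_apply, Finset.sum_eq_single (fun i : Fin m => (Z (t + (i : ℕ)) ω).2)]
    · exact Set.indicator_of_mem (show ω ∈ Aev Z t _ from fun i => rfl) _
    · intro v _ hv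
      refine Set.indicator_of_notMem (fun h => hv ?_) _
      funext i
      exact (h i).symm
    · simp
  rw [h2, condExp_const (obs_le hZ l n)] at h1
  filter_upwards [h1] with ω hω
  rw [hω, Finset.sum_apply]
  rfl

lemma forget_zero {P : Measure Ω} {Z : ℕ → Ω → 𝓧 × 𝓨} {κ : Kernel (𝓧 × 𝓨) (𝓧 × 𝓨)}
    [IsMarkovKernel κ]
    {μ : Measure 𝓧} {q : 𝓧 × 𝓨 → 𝓧 × 𝓨 → ℝ≥0∞} {p0 : 𝓧 × 𝓨 → ℝ≥0∞} {R : ℕ}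
    (hP : IsPMM P Z κ μ q p0) {S1 S2 : Finset 𝓨} {M : ℝ} (hM : 1 ≤ M)
    (hG : ∀ᵐ ω ∂P, ∀ N, ∃ t, N ≤ t ∧ Gblk q R S1 S2 M (xp Z ω) t) (s : ℕ) :
    ∀ᵐ ω ∂P, ∀ ε : ℝ, 0 < ε → ∃ T : ℕ, ∀ t, T ≤ t → s ≤ t →
      ∀ n, t ≤ n → ∀ m, tvBlock P Z t 0 s n m ω ≤ ε := by
  have hP' := hP
  obtain ⟨h1, h2, h3, h4, h5, h6, h7⟩ := hP
  have hcmp : ∀ᵐ ω ∂P, ∀ (t n m : ℕ) (v : Fin m → 𝓨) (lo hi : ℚ), s ≤ t → t ≤ n →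
      (0 : ℝ) ≤ lo → (0 : ℝ) ≤ hi →
      xp Z ω ∈ Bset μ p0 q s t (ENNReal.ofReal lo) (ENNReal.ofReal hi) →
      (lo : ℝ) * smooth P Z t s n v ω ≤ (hi : ℝ) * smooth P Z t 0 n v ω := by
    simp only [ae_all_iff]
    intro t n m v lo hi hst htn hlo hhi
    exact smooth_compare hP' hst htn v hlo hhi
  have hs0 : ∀ᵐ ω ∂P, ∀ t n m, ∑ v : Fin m → 𝓨, smooth P Z t 0 n v ω = 1 := by
    simp only [ae_all_iff]
    exact fun t n m => smooth_sum h2.1 t 0 n m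
  have hss : ∀ᵐ ω ∂P, ∀ t n m, ∑ v : Fin m → 𝓨, smooth P Z t s n v ω = 1 := by
    simp only [ae_all_iff]
    exact fun t n m => smooth_sum h2.1 t s n m
  have hnn : ∀ᵐ ω ∂P, ∀ (t n m : ℕ) (v : Fin m → 𝓨), 0 ≤ smooth P Z t 0 n v ω := by
    simp only [ae_all_iff]
    exact fun t n m v => smooth_nonneg Z t 0 n v
  filter_upwards [hcmp, hs0, hss, hnn, hG, alp_pos hP', alp_fin hP', alp'_fin hP' s,
    alp'_supp hP' s] with ω c1 c2 c3 c4 c5 c6 c7 c8 c9 ε hε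
  obtain ⟨lo, hi, d1, d2, d3, T, d4⟩ := contraction h4 h5 hM c7 c8 (fun t => ⟨_, c6 t⟩) c9 c5
    (half_pos hε)
  obtain ⟨hi', e1, e2⟩ := exists_rat_btwn d3
  have hpe : 0 < 1 + ε / 2 := by linarith
  have e3 : (hi' : ℝ) / (1 + ε / 2) < lo := by
    rw [div_lt_iff₀ hpe]; linarith
  obtain ⟨lo', f1, f2⟩ := exists_rat_btwn e3
  have hhi0 : (0 : ℝ) < hi' := by linarith
  have hlo0 : (0 : ℝ) < lo' := (div_pos hhi0 hpe).trans f1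
  have f3 : (hi' : ℝ) ≤ (1 + ε / 2) * lo' := by
    rw [div_lt_iff₀ hpe] at f1; linarith
  refine ⟨T, fun t htT hst n htn m => ?_⟩
  have hB : xp Z ω ∈ Bset μ p0 q s t (ENNReal.ofReal lo') (ENNReal.ofReal hi') := by
    intro i
    obtain ⟨g1, g2⟩ := d4 t htT i
    refine ⟨le_trans ?_ g1, g2.trans ?_⟩
    · gcongr
    · gcongr
  have hle : ∀ v : Fin m → 𝓨, smooth P Z t s n v ω ≤ (1 + ε / 2) * smooth P Z t 0 n v ω := by
    intro v
    have a1 := c1 t n m v lo' hi' hst htn hlo0.le hhi0.le hB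
    have a2 := mul_le_mul_of_nonneg_right f3 (c4 t n m v)
    have a3 : (lo' : ℝ) * smooth P Z t s n v ω ≤
        lo' * ((1 + ε / 2) * smooth P Z t 0 n v ω) := by linarith
    exact le_of_mul_le_mul_left a3 hlo0
  calc tvBlock P Z t 0 s n m ω ≤ ∑ v : Fin m → 𝓨, ((smooth P Z t 0 n v ω - smooth P Z t s n v ω) +
        ε * smooth P Z t 0 n v ω) := by
        refine Finset.sum_le_sum fun v _ => ?_
        have a1 := hle v
        have a2 := mul_nonneg hε.le (c4 t n m v)
        rw [abs_le]
        constructor <;> linarith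
    _ = ε := by
        rw [Finset.sum_add_distrib, Finset.sum_sub_distrib, ← Finset.mul_sum, c2, c3]
        ring

end Final

/-- Theorem 1 (i). If the PMM `Z` satisfies **A1**, **A2** and is Harris
recurrent, then for all fixed `l ≤ s`, almost surely
`sup_{n ≥ t} sup_{m ≥ 1} ‖ν^t_{l:n;m} − ν^t_{s:n;m}‖_TV → 0` as `t → ∞`. -/
theorem forgetting_of_smoothing
    [TopologicalSpace 𝓧] [PolishSpace 𝓧] [BorelSpace 𝓧]
    (P : Measure Ω) (Z : ℕ → Ω → 𝓧 × 𝓨) (κ : Kernel (𝓧 × 𝓨) (𝓧 × 𝓨)) (μ : Measure 𝓧)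
    (q : 𝓧 × 𝓨 → 𝓧 × 𝓨 → ℝ≥0∞) (p0 : 𝓧 × 𝓨 → ℝ≥0∞)
    (Pz : 𝓧 × 𝓨 → Measure (ℕ → 𝓧 × 𝓨)) (ψ : Measure (𝓧 × 𝓨))
    {R : ℕ} (E : Set (Fin (R + 1) → 𝓧)) (Yp : Set (𝓨 × 𝓨))
    (hPMM : IsPMM P Z κ μ q p0)
    (hA1 : Assumption1 q E Yp) (hA2 : Assumption2 κ ψ μ E Yp)
    (hFam : IsMarkovFamily κ Pz) (hHarris : HarrisProp κ Pz ψ) :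
    ∀ l s : ℕ, ∀ᵐ ω ∂P, ∀ ε : ℝ, 0 < ε → ∃ T : ℕ, ∀ t, T ≤ t → l ≤ t → s ≤ t →
      ∀ n, t ≤ n → ∀ m, 1 ≤ m → tvBlock P Z t l s n m ω ≤ ε := by
  intro l s
  have := family_markov hFam
  obtain ⟨S1, S2, M, hM, hG⟩ := good_blocks hPMM hA1 hA2 hFam hHarris
  filter_upwards [forget_zero hPMM hM hG l, forget_zero hPMM hM hG s] with ω h1 h2 ε hε
  obtain ⟨T1, hT1⟩ := h1 (ε / 2) (half_pos hε)
  obtain ⟨T2, hT2⟩ := h2 (ε / 2) (half_pos hε)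
  refine ⟨max T1 T2, fun t ht hl hs n hn m _ => ?_⟩
  have a1 := hT1 t (le_trans (le_max_left _ _) ht) hl n hn m
  have a2 := hT2 t (le_trans (le_max_right _ _) ht) hs n hn m
  have a3 : tvBlock P Z t l s n m ω ≤ tvBlock P Z t 0 l n m ω + tvBlock P Z t 0 s n m ω := by
    simp only [tvBlock]
    rw [← Finset.sum_add_distrib]
    refine Finset.sum_le_sum fun v _ => ?_
    rw [abs_sub_comm (smooth P Z t 0 n v ω) (smooth P Z t l n v ω)]
    exact abs_sub_le _ _ _
  linarith

end PMMPaper
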